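/- Every Bad Configuration contains a cycle of length at least 7; consequently, every graph G in which all cycles have length at most 6 is strongly efficient for every placement of the terminal pairs (s_1,t_1),(s_2,t_2). -/

import Mathlib

namespace NDG

variable {V : Type*} [DecidableEq V]

/-- Total cost of a finite set of edges. -/
def cost (c : Sym2 V → ℝ) (F : Finset (Sym2 V)) : ℝ := ∑ e ∈ F, c e

/-- A Steiner forest: an acyclic set of edges of `G` connecting both
terminal pairs. -/
def IsSteinerForest (G : SimpleGraph V) (s₁ t₁ s₂ t₂ : V) (F : Finset (Sym2 V)) : Prop :=
  (↑F ⊆ G.edgeSet) ∧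
  (SimpleGraph.fromEdgeSet (↑F : Set (Sym2 V))).IsAcyclic ∧
  (∃ p : G.Walk s₁ t₁, p.IsPath ∧ ∀ e ∈ p.edges, e ∈ F) ∧
  (∃ p : G.Walk s₂ t₂, p.IsPath ∧ ∀ e ∈ p.edges, e ∈ F)

/-- An optimal Steiner forest: one of minimum total cost. -/
def IsOptimalSteinerForest (G : SimpleGraph V) (s₁ t₁ s₂ t₂ : V) (c : Sym2 V → ℝ)
    (F : Finset (Sym2 V)) : Prop :=
  IsSteinerForest G s₁ t₁ s₂ t₂ F ∧
  ∀ F', IsSteinerForest G s₁ t₁ s₂ t₂ F' → cost c F ≤ cost c F'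

/-- A strategy of a player: a simple path between her terminals. -/
abbrev Strat (G : SimpleGraph V) (s t : V) := {p : G.Walk s t // p.IsPath}

/-- A cost sharing protocol: cost shares for both players on every edge,
depending on the chosen strategy profile. -/
abbrev Protocol (G : SimpleGraph V) (s₁ t₁ s₂ t₂ : V) :=
  Strat G s₁ t₁ → Strat G s₂ t₂ → Fin 2 → Sym2 V → ℝ

/-- The set of players using edge `e` in the profile `(P₁, P₂)`. -/
def usedBy {G : SimpleGraph V} {s₁ t₁ s₂ t₂ : V}
    (P₁ : Strat G s₁ t₁) (P₂ : Strat G s₂ t₂) (e : Sym2 V) : Finset (Fin 2) :=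
  (if e ∈ P₁.1.edges then {0} else ∅) ∪ (if e ∈ P₂.1.edges then {1} else ∅)

/-- The total cost player 1 pays. -/
def cost₁ {G : SimpleGraph V} {s₁ t₁ s₂ t₂ : V} (Ξ : Protocol G s₁ t₁ s₂ t₂)
    (P₁ : Strat G s₁ t₁) (P₂ : Strat G s₂ t₂) : ℝ :=
  ∑ e ∈ P₁.1.edges.toFinset, Ξ P₁ P₂ 0 e

/-- The total cost player 2 pays. -/
def cost₂ {G : SimpleGraph V} {s₁ t₁ s₂ t₂ : V} (Ξ : Protocol G s₁ t₁ s₂ t₂)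
    (P₁ : Strat G s₁ t₁) (P₂ : Strat G s₂ t₂) : ℝ :=
  ∑ e ∈ P₂.1.edges.toFinset, Ξ P₁ P₂ 1 e

/-- Pure Nash equilibrium of the two-player game induced by the protocol `Ξ`. -/
def IsPNE {G : SimpleGraph V} {s₁ t₁ s₂ t₂ : V} (Ξ : Protocol G s₁ t₁ s₂ t₂)
    (P₁ : Strat G s₁ t₁) (P₂ : Strat G s₂ t₂) : Prop :=
  (∀ Q₁, cost₁ Ξ P₁ P₂ ≤ cost₁ Ξ Q₁ P₂) ∧ (∀ Q₂, cost₂ Ξ P₁ P₂ ≤ cost₂ Ξ P₁ Q₂)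

/-- A separable cost sharing protocol: nonnegative, budget-balanced, stable and
separable (cost shares on an edge depend only on the set of players using it). -/
structure IsSeparable {G : SimpleGraph V} {s₁ t₁ s₂ t₂ : V} (c : Sym2 V → ℝ)
    (Ξ : Protocol G s₁ t₁ s₂ t₂) : Prop where
  nonneg : ∀ P₁ P₂ i e, 0 ≤ Ξ P₁ P₂ i e
  budget : ∀ P₁ P₂ e, (usedBy P₁ P₂ e).Nonempty →
    ∑ i ∈ usedBy P₁ P₂ e, Ξ P₁ P₂ i e = c e
  stable : ∃ P₁ P₂, IsPNE Ξ P₁ P₂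
  separable : ∀ P₁ P₂ Q₁ Q₂ e, usedBy P₁ P₂ e = usedBy Q₁ Q₂ e →
    ∀ i, Ξ P₁ P₂ i e = Ξ Q₁ Q₂ i e

/-- A Steiner forest `F` is enforceable if the profile of the unique paths of
the two players inside `F` is a pure Nash equilibrium of the game induced by
some separable cost sharing protocol. -/
def Enforceable (G : SimpleGraph V) (s₁ t₁ s₂ t₂ : V) (c : Sym2 V → ℝ)
    (F : Finset (Sym2 V)) : Prop :=
  ∃ (P₁ : Strat G s₁ t₁) (P₂ : Strat G s₂ t₂),
    (∀ e ∈ P₁.1.edges, e ∈ F) ∧ (∀ e ∈ P₂.1.edges, e ∈ F) ∧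
    (∀ Q₁ : Strat G s₁ t₁, (∀ e ∈ Q₁.1.edges, e ∈ F) → Q₁ = P₁) ∧
    (∀ Q₂ : Strat G s₂ t₂, (∀ e ∈ Q₂.1.edges, e ∈ F) → Q₂ = P₂) ∧
    ∃ Ξ : Protocol G s₁ t₁ s₂ t₂, IsSeparable c Ξ ∧ IsPNE Ξ P₁ P₂

/-- `(G,(s₁,t₁),(s₂,t₂))` is efficient: for every nonnegative cost function
some optimal Steiner forest is enforceable (the PoS is 1). -/
def Efficient (G : SimpleGraph V) (s₁ t₁ s₂ t₂ : V) : Prop :=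
  ∀ c : Sym2 V → ℝ, (∀ e, 0 ≤ c e) →
    ∃ F, IsOptimalSteinerForest G s₁ t₁ s₂ t₂ c F ∧ Enforceable G s₁ t₁ s₂ t₂ c F

/-- `(G,(s₁,t₁),(s₂,t₂))` is strongly efficient: for every nonnegative cost
function every optimal Steiner forest is enforceable. -/
def StronglyEfficient (G : SimpleGraph V) (s₁ t₁ s₂ t₂ : V) : Prop :=
  ∀ c : Sym2 V → ℝ, (∀ e, 0 ≤ c e) →
    ∀ F, IsOptimalSteinerForest G s₁ t₁ s₂ t₂ c F → Enforceable G s₁ t₁ s₂ t₂ c F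

/-- A preliminary bad configuration (PBC) for the terminal pairs `(u,v)` and
`(w,x)`: the path `P_u = Lu ++ M ++ Ru` of one player and the path
`P_ℓ = Ll ++ M ++ Rl` of the other player meet exactly in the nonempty,
consistently oriented common subpath `M`; `q₁` closes a unique cycle with `P_u`
(intersecting it in the segment `S1`, which contains edges of `R_u` and of `M`),
`q₂` and `q₃` close unique cycles with `P_ℓ` (intersecting it in the segments
`S2` resp. `S3`, containing edges of `L_ℓ` resp. `R_ℓ` and of `M`, and missing
part of `M`); moreover `C := C₂ ∩ C₃ ∩ M` is nonempty and contained in `C₁`, and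
`(M ∩ C₁ ∩ C₂) \ C` and `(M ∩ C₁ ∩ C₃) \ C` each contain an edge. -/
structure PBC (G : SimpleGraph V) (u v w x : V) where
  a : V
  b : V
  Lu : G.Walk u a
  M : G.Walk a b
  Ru : G.Walk b v
  Ll : G.Walk w a
  Rl : G.Walk b x
  hM_ne : M.edges ≠ []
  hPu : ((Lu.append M).append Ru).IsPath
  hPl : ((Ll.append M).append Rl).IsPath
  hforest : (SimpleGraph.fromEdgeSet
      {e | e ∈ ((Lu.append M).append Ru).edges ∨ e ∈ ((Ll.append M).append Rl).edges}).IsAcyclic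
  hmeet : ∀ e, e ∈ ((Lu.append M).append Ru).edges →
      e ∈ ((Ll.append M).append Rl).edges → e ∈ M.edges
  hRu_ne : Ru.edges ≠ []
  hLl_ne : Ll.edges ≠ []
  hRl_ne : Rl.edges ≠ []
  a1 : V
  b1 : V
  q1 : G.Walk a1 b1
  S1 : G.Walk a1 b1
  hq1path : q1.IsPath
  hq1_ne : q1.edges ≠ []
  hS1 : S1.darts <:+: ((Lu.append M).append Ru).darts
  hq1closes : ∀ y ∈ q1.support, y ∈ ((Lu.append M).append Ru).support → y = a1 ∨ y = b1
  hC1Ru : ∃ e ∈ S1.edges, e ∈ Ru.edges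
  hC1M : ∃ e ∈ S1.edges, e ∈ M.edges
  a2 : V
  b2 : V
  q2 : G.Walk a2 b2
  S2 : G.Walk a2 b2
  hq2path : q2.IsPath
  hq2_ne : q2.edges ≠ []
  hS2 : S2.darts <:+: ((Ll.append M).append Rl).darts
  hq2closes : ∀ y ∈ q2.support, y ∈ ((Ll.append M).append Rl).support → y = a2 ∨ y = b2
  hC2Ll : ∃ e ∈ S2.edges, e ∈ Ll.edges
  hC2M : ∃ e ∈ S2.edges, e ∈ M.edges
  hMC2 : ∃ e ∈ M.edges, e ∉ S2.edges
  a3 : V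
  b3 : V
  q3 : G.Walk a3 b3
  S3 : G.Walk a3 b3
  hq3path : q3.IsPath
  hq3_ne : q3.edges ≠ []
  hS3 : S3.darts <:+: ((Ll.append M).append Rl).darts
  hq3closes : ∀ y ∈ q3.support, y ∈ ((Ll.append M).append Rl).support → y = a3 ∨ y = b3
  hC3Rl : ∃ e ∈ S3.edges, e ∈ Rl.edges
  hC3M : ∃ e ∈ S3.edges, e ∈ M.edges
  hMC3 : ∃ e ∈ M.edges, e ∉ S3.edges
  hC_ne : ∃ e ∈ M.edges, e ∈ S2.edges ∧ e ∈ S3.edges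
  hC_sub : ∀ e ∈ M.edges, e ∈ S2.edges → e ∈ S3.edges → e ∈ S1.edges
  hC1C2 : ∃ e ∈ M.edges, e ∈ S1.edges ∧ e ∈ S2.edges ∧ e ∉ S3.edges
  hC1C3 : ∃ e ∈ M.edges, e ∈ S1.edges ∧ e ∈ S3.edges ∧ e ∉ S2.edges

namespace PBC

variable {G : SimpleGraph V} {u v w x : V}

/-- The path of the "upper" player (terminals `u`, `v`). -/
def Pu (B : PBC G u v w x) : G.Walk u v := (B.Lu.append B.M).append B.Ru

/-- The path of the "lower" player (terminals `w`, `x`). -/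
def Pl (B : PBC G u v w x) : G.Walk w x := (B.Ll.append B.M).append B.Rl

/-- `q₁` is small: the cycle `C₁` contains no edge of `L_u`. -/
def Small (B : PBC G u v w x) : Prop := ∀ e ∈ B.S1.edges, e ∉ B.Lu.edges

/-- `q₁` is big: the cycle `C₁` contains an edge of `L_u`. -/
def Big (B : PBC G u v w x) : Prop := ∃ e ∈ B.S1.edges, e ∈ B.Lu.edges

/-- Node-disjointness of two walks. -/
def NodeDisj {y z y' z' : V} (p : G.Walk y z) (q : G.Walk y' z') : Prop :=
  ∀ s ∈ p.support, s ∉ q.support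

/-- `q` is internally node-disjoint from `P_u ∪ P_ℓ`. -/
def InternDisj (B : PBC G u v w x) {y z : V} (q : G.Walk y z) : Prop :=
  ∀ s ∈ q.support, s ≠ y → s ≠ z → s ∉ B.Pu.support ∧ s ∉ B.Pl.support

/-- The two walks intersect exactly in a common (possibly reversed) subpath. -/
def CommonMid {y z y' z' : V} (p : G.Walk y z) (q : G.Walk y' z') : Prop :=
  ∃ (c d : V) (m : G.Walk c d), m.IsPath ∧
    m.darts <:+: p.darts ∧ (m.darts <:+: q.darts ∨ m.reverse.darts <:+: q.darts) ∧
    ∀ s, s ∈ p.support → s ∈ q.support → s ∈ m.support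

/-- `q` contains no node of `L_u` or `R_u`. -/
def AvoidsUpperOuter (B : PBC G u v w x) {y z : V} (q : G.Walk y z) : Prop :=
  ∀ s ∈ q.support, s ∉ B.Lu.support ∧ s ∉ B.Ru.support

/-- In BC3/BC4, `q₁` avoids `R_ℓ` and the start node of `q₂`, and its initial
segment `α₁` (up to the last node contained in `L_ℓ`) runs inside the cycle
`C₂` along `L_ℓ`. -/
def LlTraverse (B : PBC G u v w x) : Prop :=
  (∀ s ∈ B.q1.support, s ∉ B.Rl.support) ∧
  B.a2 ∉ B.q1.support ∧
  ∃ (y : V) (α : G.Walk B.a1 y) (β : G.Walk y B.b1),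
    B.q1 = α.append β ∧ y ∈ B.Ll.support ∧
    (∀ e ∈ α.edges, e ∈ B.S2.edges) ∧
    (∀ s ∈ β.support, s ∈ B.Ll.support → s = y)

/-- Types BC1a (`q₁` small) and BC1b (`q₁` big): `q₁,q₂,q₃` pairwise
node-disjoint and internally node-disjoint from `P_u ∪ P_ℓ`. -/
def BC1 (B : PBC G u v w x) : Prop :=
  NodeDisj B.q1 B.q2 ∧ NodeDisj B.q1 B.q3 ∧ NodeDisj B.q2 B.q3 ∧
  B.InternDisj B.q1 ∧ B.InternDisj B.q2 ∧ B.InternDisj B.q3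

/-- Types BC2a–d: `q₃` node-disjoint with `q₁` and `q₂`; `q₁` and `q₂` overlap
exactly in a common subpath (`α₂ = β₂`); everything internally node-disjoint
from `P_u ∪ P_ℓ` (the subtypes corresponding to `q₁` small/big and the two
orientations of the common subpath are subsumed). -/
def BC2 (B : PBC G u v w x) : Prop :=
  NodeDisj B.q3 B.q1 ∧ NodeDisj B.q3 B.q2 ∧
  ¬ NodeDisj B.q1 B.q2 ∧ CommonMid B.q1 B.q2 ∧
  B.InternDisj B.q1 ∧ B.InternDisj B.q2 ∧ B.InternDisj B.q3

/-- Type BC3. -/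
def BC3 (B : PBC G u v w x) : Prop :=
  B.Small ∧ (∀ e ∈ B.M.edges, e ∈ B.S1.edges) ∧
  NodeDisj B.q1 B.q2 ∧ NodeDisj B.q1 B.q3 ∧ NodeDisj B.q2 B.q3 ∧
  B.AvoidsUpperOuter B.q2 ∧ B.AvoidsUpperOuter B.q3 ∧
  B.LlTraverse

/-- Types BC4a/b. -/
def BC4 (B : PBC G u v w x) : Prop :=
  B.Small ∧ (∀ e ∈ B.M.edges, e ∈ B.S1.edges) ∧
  NodeDisj B.q3 B.q1 ∧ NodeDisj B.q3 B.q2 ∧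
  ¬ NodeDisj B.q1 B.q2 ∧ CommonMid B.q1 B.q2 ∧
  B.AvoidsUpperOuter B.q2 ∧ B.AvoidsUpperOuter B.q3 ∧
  B.LlTraverse

/-- A PBC is a bad configuration if it is of one of the nine types
BC1a, BC1b, BC2a, BC2b, BC2c, BC2d, BC3, BC4a, BC4b. -/
def IsBC (B : PBC G u v w x) : Prop := B.BC1 ∨ B.BC2 ∨ B.BC3 ∨ B.BC4

end PBC

/-- `(G,(s₁,t₁),(s₂,t₂))` contains a subgraph which is a bad configuration,
for some assignment of the terminal pairs to `(u,v)` and `(w,x)`. -/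
def ContainsBC (G : SimpleGraph V) (s₁ t₁ s₂ t₂ : V) : Prop :=
  (∃ B : PBC G s₁ t₁ s₂ t₂, B.IsBC) ∨ (∃ B : PBC G s₁ t₁ t₂ s₂, B.IsBC) ∨
  (∃ B : PBC G t₁ s₁ s₂ t₂, B.IsBC) ∨ (∃ B : PBC G t₁ s₁ t₂ s₂, B.IsBC) ∨
  (∃ B : PBC G s₂ t₂ s₁ t₁, B.IsBC) ∨ (∃ B : PBC G s₂ t₂ t₁ s₁, B.IsBC) ∨
  (∃ B : PBC G t₂ s₂ s₁ t₁, B.IsBC) ∨ (∃ B : PBC G t₂ s₂ t₁ s₁, B.IsBC)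


section helpers
variable {U : Type*} {G : SimpleGraph U}

lemma path_append {u v w : U} {p : G.Walk u v} {q : G.Walk v w} (hp : p.IsPath) (hq : q.IsPath)
    (h : ∀ x, x ∈ p.support → x ∈ q.support → x = v) : (p.append q).IsPath := by
  rw [SimpleGraph.Walk.isPath_def, SimpleGraph.Walk.support_append, List.nodup_append']
  refine ⟨hp.support_nodup, hq.support_nodup.tail, ?_⟩
  intro x hx hx'
  have hxv := h x hx (List.mem_of_mem_tail hx')
  subst hxv
  have := hq.support_nodup
  rw [SimpleGraph.Walk.support_eq_cons] at this
  exact (List.nodup_cons.1 this).1 hx'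

lemma append_disj {u v w : U} {p : G.Walk u v} {q : G.Walk v w} (hp : (p.append q).IsPath)
    {x : U} (h1 : x ∈ p.support) (h2 : x ∈ q.support) : x = v := by
  by_contra hne
  exact hp.ne_of_mem_support_of_append hne h1 h2 rfl

lemma cyc_append {u v : U} {p : G.Walk u v} {q : G.Walk v u} (hp : p.IsPath) (hq : q.IsPath)
    (h : ∀ x, x ∈ p.support → x ∈ q.support → x = u ∨ x = v)
    (hn : 1 < p.length ∨ 1 < q.length) : (p.append q).IsCycle := by
  refine hp.isCycle_append hq ?_ hn
  intro x hx hx'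
  have h1 := hp.support_nodup
  rw [SimpleGraph.Walk.support_eq_cons] at h1
  have h2 := hq.support_nodup
  rw [SimpleGraph.Walk.support_eq_cons] at h2
  rcases h x (List.mem_of_mem_tail hx) (List.mem_of_mem_tail hx') with rfl | rfl
  · exact (List.nodup_cons.1 h1).1 hx
  · exact (List.nodup_cons.1 h2).1 hx'

/-- Six paths arranged cyclically form a cycle. -/
lemma hexagon {v1 v2 v3 v4 v5 v6 : U} {p1 : G.Walk v1 v2} {p2 : G.Walk v2 v3} {p3 : G.Walk v3 v4}
    {p4 : G.Walk v4 v5} {p5 : G.Walk v5 v6} {p6 : G.Walk v6 v1}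
    (h1 : p1.IsPath) (h2 : p2.IsPath) (h3 : p3.IsPath) (h4 : p4.IsPath) (h5 : p5.IsPath)
    (h6 : p6.IsPath)
    (l1 : 1 ≤ p1.length) (l2 : 1 ≤ p2.length) 
    (h12 : ∀ x, x ∈ p1.support → x ∈ p2.support → x = v2)
    (h23 : ∀ x, x ∈ p2.support → x ∈ p3.support → x = v3)
    (h34 : ∀ x, x ∈ p3.support → x ∈ p4.support → x = v4)
    (h45 : ∀ x, x ∈ p4.support → x ∈ p5.support → x = v5)
    (h56 : ∀ x, x ∈ p5.support → x ∈ p6.support → x = v6)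
    (h61 : ∀ x, x ∈ p6.support → x ∈ p1.support → x = v1)
    (h13 : ∀ x, x ∈ p1.support → x ∉ p3.support)
    (h14 : ∀ x, x ∈ p1.support → x ∉ p4.support)
    (h15 : ∀ x, x ∈ p1.support → x ∉ p5.support)
    (h24 : ∀ x, x ∈ p2.support → x ∉ p4.support)
    (h25 : ∀ x, x ∈ p2.support → x ∉ p5.support)
    (h26 : ∀ x, x ∈ p2.support → x ∉ p6.support)
    (h35 : ∀ x, x ∈ p3.support → x ∉ p5.support)
    (h36 : ∀ x, x ∈ p3.support → x ∉ p6.support)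
    (h46 : ∀ x, x ∈ p4.support → x ∉ p6.support) :
    ∃ C : G.Walk v1 v1, C.IsCycle ∧ C.length = p1.length + p2.length + p3.length + p4.length
      + p5.length + p6.length ∧ ∀ e ∈ C.edges, e ∈ p1.edges ∨ e ∈ p2.edges ∨ e ∈ p3.edges ∨
        e ∈ p4.edges ∨ e ∈ p5.edges ∨ e ∈ p6.edges := by
  have k12 := path_append h1 h2 h12
  have k123 : ((p1.append p2).append p3).IsPath := by
    refine path_append k12 h3 ?_
    intro x; simp only [SimpleGraph.Walk.mem_support_append_iff]; grind
  have k1234 : (((p1.append p2).append p3).append p4).IsPath := by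
    refine path_append k123 h4 ?_
    intro x; simp only [SimpleGraph.Walk.mem_support_append_iff]; grind
  have k12345 : ((((p1.append p2).append p3).append p4).append p5).IsPath := by
    refine path_append k1234 h5 ?_
    intro x; simp only [SimpleGraph.Walk.mem_support_append_iff]; grind
  refine ⟨_, cyc_append k12345 h6 ?_ ?_, ?_, ?_⟩
  · intro x; simp only [SimpleGraph.Walk.mem_support_append_iff]; grind
  · left; simp only [SimpleGraph.Walk.length_append]; omega
  · simp only [SimpleGraph.Walk.length_append]
  · intro e he; simp only [SimpleGraph.Walk.edges_append, List.mem_append] at he; tauto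

/-- Uniqueness of paths in forests. -/
lemma forest_unique {S : Set (Sym2 U)} (hS : (SimpleGraph.fromEdgeSet S).IsAcyclic) {u v : U}
    {p q : G.Walk u v} (hp : p.IsPath) (hq : q.IsPath) (hpS : ∀ e ∈ p.edges, e ∈ S)
    (hqS : ∀ e ∈ q.edges, e ∈ S) : p = q := by
  have hp' : ∀ e ∈ p.edges, e ∈ (SimpleGraph.fromEdgeSet S).edgeSet := by
    intro e he
    rw [SimpleGraph.edgeSet_fromEdgeSet]
    exact ⟨hpS e he, fun hd => G.not_isDiag_of_mem_edgeSet (p.edges_subset_edgeSet he) hd⟩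
  have hq' : ∀ e ∈ q.edges, e ∈ (SimpleGraph.fromEdgeSet S).edgeSet := by
    intro e he
    rw [SimpleGraph.edgeSet_fromEdgeSet]
    exact ⟨hqS e he, fun hd => G.not_isDiag_of_mem_edgeSet (q.edges_subset_edgeSet he) hd⟩
  have := hS.path_unique ⟨_, hp.transfer hp'⟩ ⟨_, hq.transfer hq'⟩
  have h2 : (p.transfer _ hp').support = (q.transfer _ hq').support := by
    rw [Subtype.mk.injEq] at this; rw [this]
  rw [SimpleGraph.Walk.support_transfer, SimpleGraph.Walk.support_transfer] at h2
  exact SimpleGraph.Walk.ext_support h2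

/-- Splitting a walk at a vertex. -/
lemma split_at {u v x : U} (p : G.Walk u v) (hx : x ∈ p.support) :
    ∃ (q : G.Walk u x) (r : G.Walk x v), p = q.append r :=
  p.mem_support_iff_exists_append.1 hx

/-- Splitting a walk at the last vertex satisfying a predicate. -/
lemma split_last {u v : U} (p : G.Walk u v) (S : Set U) (hu : u ∈ S) :
    ∃ (x : U) (q : G.Walk u x) (r : G.Walk x v), p = q.append r ∧ x ∈ S ∧
      (∀ y ∈ r.support, y ∈ S → y = x) := by
  classical
  induction p with
  | nil => exact ⟨_, .nil, .nil, rfl, hu, by simp⟩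
  | @cons u w v h p ih =>
    by_cases hex : ∃ z ∈ p.support, z ∈ S
    · -- restrict to a suffix starting in S
      by_cases hw : w ∈ S
      · obtain ⟨x, q, r, rfl, hx, hr⟩ := ih hw
        exact ⟨x, q.cons h, r, rfl, hx, hr⟩
      · -- use strong statement through S ∪ {w}
        obtain ⟨x, q, r, hp, hx, hr⟩ : ∃ (x : U) (q : G.Walk w x) (r : G.Walk x v),
            p = q.append r ∧ x ∈ S ∧ (∀ y ∈ r.support, y ∈ S → y = x) := by
          clear ih hu h hw
          induction p with
          | nil => 
            obtain ⟨z, hz, hzS⟩ := hex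
            simp only [SimpleGraph.Walk.support_nil, List.mem_singleton] at hz
            subst hz
            exact ⟨_, .nil, .nil, rfl, hzS, by simp⟩
          | @cons a b d h p ih =>
            by_cases hex' : ∃ z ∈ p.support, z ∈ S
            · obtain ⟨x, q, r, rfl, hx, hr⟩ := ih hex'
              exact ⟨x, q.cons h, r, rfl, hx, hr⟩
            · obtain ⟨z, hz, hzS⟩ := hex
              rw [SimpleGraph.Walk.support_cons, List.mem_cons] at hz
              rcases hz with rfl | hz
              · refine ⟨_, .nil, .cons h p, rfl, hzS, ?_⟩
                intro y hy hyS
                rw [SimpleGraph.Walk.support_cons, List.mem_cons] at hy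
                rcases hy with rfl | hy
                · rfl
                · exact (hex' ⟨y, hy, hyS⟩).elim
              · exact (hex' ⟨z, hz, hzS⟩).elim
        exact ⟨x, q.cons h, r, by rw [hp]; rfl, hx, hr⟩
    · refine ⟨_, .nil, .cons h p, rfl, hu, ?_⟩
      intro y hy hyS
      rw [SimpleGraph.Walk.support_cons, List.mem_cons] at hy
      rcases hy with rfl | hy
      · rfl
      · exact (hex ⟨y, hy, hyS⟩).elim

/-- Splitting a walk at the first vertex satisfying a predicate. -/
lemma split_first {u v : U} (p : G.Walk u v) (S : Set U) (hv : v ∈ S) :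
    ∃ (x : U) (q : G.Walk u x) (r : G.Walk x v), p = q.append r ∧ x ∈ S ∧
      (∀ y ∈ q.support, y ∈ S → y = x) := by
  obtain ⟨x, q, r, h, hx, hr⟩ := split_last p.reverse S hv
  refine ⟨x, r.reverse, q.reverse, ?_, hx, ?_⟩
  · rw [← SimpleGraph.Walk.reverse_append, ← h, SimpleGraph.Walk.reverse_reverse]
  · simpa using hr

lemma edge_supp {u v : U} {p : G.Walk u v} {x y : U} (h : s(x, y) ∈ p.edges) :
    x ∈ p.support ∧ y ∈ p.support :=
  ⟨p.fst_mem_support_of_mem_edges h, p.snd_mem_support_of_mem_edges h⟩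

/-- Segments of a walk between two positions. -/
lemma seg {u v : U} (p : G.Walk u v) {i j : ℕ} (hij : i ≤ j) (hj : j ≤ p.length) :
    ∃ q : G.Walk (p.getVert i) (p.getVert j), q.length = j - i ∧ q.IsSubwalk p ∧
      ∀ x ∈ q.support, ∃ t, i ≤ t ∧ t ≤ j ∧ x = p.getVert t := by
  have h : (p.drop i).getVert (j - i) = p.getVert j := by
    rw [SimpleGraph.Walk.drop_getVert]; congr 1; omega
  refine ⟨((p.drop i).take (j - i)).copy rfl h, ?_, ?_, ?_⟩
  · simp; omega
  · have h1 := (SimpleGraph.Walk.isSubwalk_take (p.drop i) (j - i)).trans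
      (SimpleGraph.Walk.isSubwalk_drop p i)
    rw [SimpleGraph.Walk.isSubwalk_iff_support_isInfix] at h1 ⊢
    simpa using h1
  · intro x hx
    rw [SimpleGraph.Walk.support_copy, SimpleGraph.Walk.mem_support_iff_exists_getVert] at hx
    obtain ⟨t, rfl, ht⟩ := hx
    refine ⟨i + t, by omega, ?_, ?_⟩
    · simp at ht; omega
    · simp at ht
      rw [SimpleGraph.Walk.take_getVert, SimpleGraph.Walk.drop_getVert]; congr 1; simp; omega

lemma subwalk_path {u v u' v' : U} {p : G.Walk u v} {q : G.Walk u' v'} (h : q.IsSubwalk p)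
    (hp : p.IsPath) : q.IsPath := by
  rw [SimpleGraph.Walk.isPath_def] at *
  exact (SimpleGraph.Walk.isSubwalk_iff_support_isInfix.1 h).sublist.nodup hp

end helpers

section costs
variable {U : Type*} {G : SimpleGraph U}

/-- Cost of a walk, counted with multiplicity. -/
noncomputable def wc (c : Sym2 U → ℝ) {u v : U} (p : G.Walk u v) : ℝ := (p.edges.map c).sum

lemma wc_append (c : Sym2 U → ℝ) {u v w : U} (p : G.Walk u v) (q : G.Walk v w) :
    wc c (p.append q) = wc c p + wc c q := by
  simp [wc]

lemma wc_reverse (c : Sym2 U → ℝ) {u v : U} (p : G.Walk u v) : wc c p.reverse = wc c p := by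
  simp [wc, List.sum_reverse]

lemma wc_nil (c : Sym2 U → ℝ) {u : U} : wc c (SimpleGraph.Walk.nil : G.Walk u u) = 0 := by
  simp [wc]

lemma wc_cons (c : Sym2 U → ℝ) {u v w : U} (h : G.Adj u v) (p : G.Walk v w) :
    wc c (p.cons h) = c s(u, v) + wc c p := by
  simp [wc]

lemma wc_nonneg {c : Sym2 U → ℝ} (hc : ∀ e, 0 ≤ c e) {u v : U} (p : G.Walk u v) : 0 ≤ wc c p := by
  apply List.sum_nonneg
  intro x hx
  obtain ⟨e, -, rfl⟩ := List.mem_map.1 hx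
  exact hc e

lemma wc_bypass [DecidableEq U] {c : Sym2 U → ℝ} (hc : ∀ e, 0 ≤ c e) {u v : U} (p : G.Walk u v) :
    wc c p.bypass ≤ wc c p := by
  apply List.Sublist.sum_le_sum
  · exact p.edges_bypass_sublist_edges.map c
  · intro x hx
    obtain ⟨e, -, rfl⟩ := List.mem_map.1 hx
    exact hc e

lemma wc_eq_sum (c : Sym2 U → ℝ) {u v : U} (p : G.Walk u v) :
    wc c p = ∑ t ∈ Finset.range p.length, c s(p.getVert t, p.getVert (t + 1)) := by
  induction p with
  | nil => simp [wc]
  | cons h p ih =>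
    rw [wc_cons, SimpleGraph.Walk.length_cons, Finset.sum_range_succ', ih, add_comm]
    simp

lemma mem_edges_iff {u v : U} (p : G.Walk u v) (e : Sym2 U) :
    e ∈ p.edges ↔ ∃ t < p.length, e = s(p.getVert t, p.getVert (t + 1)) := by
  induction p with
  | nil => simp
  | @cons u v w h p ih =>
    rw [SimpleGraph.Walk.edges_cons, List.mem_cons, ih]
    constructor
    · rintro (rfl | ⟨t, ht, rfl⟩)
      · exact ⟨0, by simp, by simp⟩
      · exact ⟨t + 1, by simpa using ht, by simp⟩
    · rintro ⟨t, ht, rfl⟩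
      cases t with
      | zero => left; simp
      | succ t => right; exact ⟨t, by simpa using ht, by simp⟩

lemma seg_full {u v : U} (c : Sym2 U → ℝ) (p : G.Walk u v) (hp : p.IsPath) {i j : ℕ} (hij : i ≤ j)
    (hj : j ≤ p.length) {x y : U} (hx : p.getVert i = x) (hy : p.getVert j = y) :
    ∃ q : G.Walk x y, q.IsPath ∧ q.length = j - i ∧
      wc c q = (∑ t ∈ Finset.range j, c s(p.getVert t, p.getVert (t + 1))) -
        (∑ t ∈ Finset.range i, c s(p.getVert t, p.getVert (t + 1))) ∧
      (∀ z, z ∈ q.support ↔ ∃ t, i ≤ t ∧ t ≤ j ∧ z = p.getVert t) ∧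
      (∀ e, e ∈ q.edges ↔ ∃ t, i ≤ t ∧ t < j ∧ e = s(p.getVert t, p.getVert (t + 1))) := by
  subst hx
  subst hy
  have h : (p.drop i).getVert (j - i) = p.getVert j := by
    rw [SimpleGraph.Walk.drop_getVert]; congr 1; omega
  have hlen : (((p.drop i).take (j - i)).copy rfl h).length = j - i := by simp; omega
  have hg : ∀ t ≤ j - i, (((p.drop i).take (j - i)).copy rfl h).getVert t = p.getVert (i + t) := by
    intro t ht
    simp only [SimpleGraph.Walk.getVert_copy, SimpleGraph.Walk.take_getVert,
      SimpleGraph.Walk.drop_getVert]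
    congr 1; omega
  refine ⟨((p.drop i).take (j - i)).copy rfl h, ?_, hlen, ?_, ?_, ?_⟩
  · have h1 := (SimpleGraph.Walk.isSubwalk_take (p.drop i) (j - i)).trans
      (SimpleGraph.Walk.isSubwalk_drop p i)
    have := subwalk_path h1 hp
    simpa using this
  · rw [wc_eq_sum, hlen, ← Finset.sum_Ico_eq_sub _ hij, Finset.sum_Ico_eq_sum_range]
    apply Finset.sum_congr rfl
    intro t ht
    rw [Finset.mem_range] at ht
    rw [hg t ht.le, hg (t+1) ht]
    rfl
  · intro z
    rw [SimpleGraph.Walk.mem_support_iff_exists_getVert, hlen]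
    constructor
    · rintro ⟨t, rfl, ht⟩
      exact ⟨i + t, by omega, by omega, hg t ht⟩
    · rintro ⟨t, h1, h2, rfl⟩
      refine ⟨t - i, ?_, by omega⟩
      rw [hg _ (by omega)]; congr 1; omega
  · intro e
    rw [mem_edges_iff, hlen]
    constructor
    · rintro ⟨t, ht, rfl⟩
      refine ⟨i + t, by omega, by omega, ?_⟩
      rw [hg t ht.le, hg (t+1) ht]; rfl
    · rintro ⟨t, h1, h2, rfl⟩
      refine ⟨t - i, by omega, ?_⟩
      have e1 : i + (t - i) = t := by omega
      have e2 : i + (t - i + 1) = t + 1 := by omega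
      rw [hg _ (by omega), hg _ (by omega), e1, e2]

lemma len_one {u v : U} {p : G.Walk u v} (h : p.length = 1) : G.Adj u v ∧ p.edges = [s(u, v)] := by
  cases p with
  | nil => simp at h
  | cons h' p =>
    cases p with
    | nil => exact ⟨h', by simp⟩
    | cons _ _ => simp at h

lemma len_zero {u v : U} {p : G.Walk u v} (h : p.length = 0) : u = v :=
  SimpleGraph.Walk.eq_of_length_eq_zero h

lemma len_pos {u v : U} (p : G.Walk u v) (h : u ≠ v) : 1 ≤ p.length := by
  by_contra h'
  exact h (len_zero (p := p) (by omega))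

/-- The configuration of two paths sharing a common middle part `M`. -/
structure Cfg (G : SimpleGraph U) (c : Sym2 U → ℝ) where
  s1 : U
  t1 : U
  s2 : U
  t2 : U
  a : U
  b : U
  L1 : G.Walk s1 a
  M : G.Walk a b
  R1 : G.Walk b t1
  L2 : G.Walk s2 a
  R2 : G.Walk b t2
  hc : ∀ e, 0 ≤ c e
  hp1 : ((L1.append M).append R1).IsPath
  hp2 : ((L2.append M).append R2).IsPath
  hmeet : ∀ x, x ∈ ((L1.append M).append R1).support → x ∈ ((L2.append M).append R2).support →
    x ∈ M.support
  opt : ∀ (Q1 : G.Walk s1 t1) (Q2 : G.Walk s2 t2) (l : List (Sym2 U)), (∀ e ∈ Q1.edges, e ∈ l) →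
    (∀ e ∈ Q2.edges, e ∈ l) → wc c L1 + wc c R1 + wc c L2 + wc c R2 + wc c M ≤ (l.map c).sum
  circ : ∀ (y : U) (p : G.Walk y y), p.IsCycle → p.length ≤ 6

namespace Cfg
variable {c : Sym2 U → ℝ}

/-- Swap the players. -/
@[reducible] def swap (T : Cfg G c) : Cfg G c where
  s1 := T.s2
  t1 := T.t2
  s2 := T.s1
  t2 := T.t1
  a := T.a
  b := T.b
  L1 := T.L2
  M := T.M
  R1 := T.R2
  L2 := T.L1
  R2 := T.R1
  hc := T.hc
  hp1 := T.hp2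
  hp2 := T.hp1
  hmeet := fun x h1 h2 => T.hmeet x h2 h1
  opt := fun Q1 Q2 l h1 h2 => by
    have := T.opt Q2 Q1 l h2 h1
    linarith
  circ := T.circ

/-- Reverse all walks. -/
@[reducible] def rev (T : Cfg G c) : Cfg G c where
  s1 := T.t1
  t1 := T.s1
  s2 := T.t2
  t2 := T.s2
  a := T.b
  b := T.a
  L1 := T.R1.reverse
  M := T.M.reverse
  R1 := T.L1.reverse
  L2 := T.R2.reverse
  R2 := T.L2.reverse
  hc := T.hc
  hp1 := by
    have := T.hp1.reverse
    rw [SimpleGraph.Walk.reverse_append, SimpleGraph.Walk.reverse_append,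
      SimpleGraph.Walk.append_assoc] at this
    exact this
  hp2 := by
    have := T.hp2.reverse
    rw [SimpleGraph.Walk.reverse_append, SimpleGraph.Walk.reverse_append,
      SimpleGraph.Walk.append_assoc] at this
    exact this
  hmeet := fun x h1 h2 => by
    have := T.hmeet x
    simp only [SimpleGraph.Walk.mem_support_append_iff, SimpleGraph.Walk.support_reverse,
      List.mem_reverse] at *
    tauto
  opt := fun Q1 Q2 l h1 h2 => by
    have := T.opt Q1.reverse Q2.reverse l (by simpa using h1) (by simpa using h2)
    simp only [wc_reverse]
    linarith
  circ := T.circ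

/-- Length of the common part. -/
def k (T : Cfg G c) : ℕ := T.M.length
/-- Vertices of the common part. -/
def m (T : Cfg G c) (i : ℕ) : U := T.M.getVert i
/-- Edges of the common part. -/
def E (T : Cfg G c) (i : ℕ) : Sym2 U := s(T.m i, T.m (i + 1))
/-- Cost of prefixes of the common part. -/
noncomputable def C (T : Cfg G c) (i : ℕ) : ℝ := ∑ t ∈ Finset.range i, c (T.E t)

variable (T : Cfg G c)

lemma m_zero : T.m 0 = T.a := by simp [m]
lemma m_k : T.m T.k = T.b := by simp [m, k]
lemma C_zero : T.C 0 = 0 := by simp [C]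
lemma C_k : T.C T.k = wc c T.M := by rw [wc_eq_sum]; rfl
lemma C_succ (i : ℕ) : T.C (i + 1) = T.C i + c (T.E i) := by
  rw [C, Finset.sum_range_succ]; rfl
lemma C_mono {i j : ℕ} (h : i ≤ j) : T.C i ≤ T.C j := by
  induction h with
  | refl => exact le_rfl
  | step _ ih => 
    have := T.C_succ
    have h2 := T.hc
    rename_i n _
    have h3 := h2 (T.E n)
    have h4 := this n
    simp only [Nat.succ_eq_add_one]
    linarith

lemma pM : T.M.IsPath := T.hp1.of_append_left.of_append_right
lemma pL1 : T.L1.IsPath := T.hp1.of_append_left.of_append_left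
lemma pR1 : T.R1.IsPath := T.hp1.of_append_right
lemma pL2 : T.L2.IsPath := T.hp2.of_append_left.of_append_left
lemma pR2 : T.R2.IsPath := T.hp2.of_append_right

lemma m_inj {i j : ℕ} (hi : i ≤ T.k) (hj : j ≤ T.k) (h : T.m i = T.m j) : i = j :=
  T.pM.getVert_injOn hi hj h

lemma m_mem {i : ℕ} : T.m i ∈ T.M.support := T.M.getVert_mem_support i

lemma mem_M {x : U} (h : x ∈ T.M.support) : ∃ i ≤ T.k, x = T.m i := by
  obtain ⟨i, h1, h2⟩ := SimpleGraph.Walk.mem_support_iff_exists_getVert.1 h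
  exact ⟨i, h2, h1.symm⟩

lemma adj_m {i : ℕ} (hi : i < T.k) : G.Adj (T.m i) (T.m (i + 1)) := T.M.adj_getVert_succ hi

lemma mem_M_edges (e : Sym2 U) : e ∈ T.M.edges ↔ ∃ t < T.k, e = T.E t := mem_edges_iff _ _

lemma E_inj {i j : ℕ} (hi : i < T.k) (hj : j < T.k) (h : T.E i = T.E j) : i = j := by
  rw [E, E, Sym2.eq_iff] at h
  rcases h with ⟨h1, _⟩ | ⟨h1, h2⟩
  · exact T.m_inj hi.le hj.le h1
  · have e1 := T.m_inj (by omega) (by omega) h1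
    have e2 := T.m_inj (by omega) (by omega) h2
    omega

lemma dLM1 {x : U} (h1 : x ∈ T.L1.support) (h2 : x ∈ T.M.support) : x = T.a :=
  append_disj T.hp1.of_append_left h1 h2
lemma dMR1 {x : U} (h1 : x ∈ T.M.support) (h2 : x ∈ T.R1.support) : x = T.b :=
  append_disj T.hp1 (by simp [SimpleGraph.Walk.mem_support_append_iff, h1]) h2
lemma dLM2 {x : U} (h1 : x ∈ T.L2.support) (h2 : x ∈ T.M.support) : x = T.a :=
  T.swap.dLM1 h1 h2
lemma dMR2 {x : U} (h1 : x ∈ T.M.support) (h2 : x ∈ T.R2.support) : x = T.b :=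
  T.swap.dMR1 h1 h2
lemma dLR1 {x : U} (h1 : x ∈ T.L1.support) (h2 : x ∈ T.R1.support) : x = T.a ∧ x = T.b := by
  have : x = T.b := append_disj T.hp1 (by simp [SimpleGraph.Walk.mem_support_append_iff, h1]) h2
  refine ⟨T.dLM1 h1 ?_, this⟩
  rw [this]; simp
lemma dLR2 {x : U} (h1 : x ∈ T.L2.support) (h2 : x ∈ T.R2.support) : x = T.a ∧ x = T.b :=
  T.swap.dLR1 h1 h2
lemma dLL {x : U} (h1 : x ∈ T.L1.support) (h2 : x ∈ T.L2.support) : x = T.a :=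
  T.dLM1 h1 (T.hmeet x (by simp [SimpleGraph.Walk.mem_support_append_iff, h1])
    (by simp [SimpleGraph.Walk.mem_support_append_iff, h2]))
lemma dRR {x : U} (h1 : x ∈ T.R1.support) (h2 : x ∈ T.R2.support) : x = T.b :=
  T.dMR1 (T.hmeet x (by simp [SimpleGraph.Walk.mem_support_append_iff, h1])
    (by simp [SimpleGraph.Walk.mem_support_append_iff, h2])) h1
lemma dL1R2 {x : U} (h1 : x ∈ T.L1.support) (h2 : x ∈ T.R2.support) : x = T.a ∧ x = T.b := by
  have := T.hmeet x (by simp [SimpleGraph.Walk.mem_support_append_iff, h1])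
    (by simp [SimpleGraph.Walk.mem_support_append_iff, h2])
  exact ⟨T.dLM1 h1 this, T.dMR2 this h2⟩
lemma dL2R1 {x : U} (h1 : x ∈ T.L2.support) (h2 : x ∈ T.R1.support) : x = T.a ∧ x = T.b :=
  T.swap.dL1R2 h1 h2

lemma seg {i j : ℕ} (hij : i ≤ j) (hj : j ≤ T.k) {x y : U} (hx : T.m i = x) (hy : T.m j = y) :
    ∃ q : G.Walk x y, q.IsPath ∧ q.length = j - i ∧ wc c q = T.C j - T.C i ∧
      (∀ z, z ∈ q.support ↔ ∃ t, i ≤ t ∧ t ≤ j ∧ z = T.m t) ∧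
      (∀ e, e ∈ q.edges ↔ ∃ t, i ≤ t ∧ t < j ∧ e = T.E t) :=
  seg_full c T.M T.pM hij hj hx hy

/-- Total cost of the configuration. -/
noncomputable def c0 : ℝ := wc c T.L1 + wc c T.R1 + wc c T.L2 + wc c T.R2 + wc c T.M

lemma swap_c0 : T.swap.c0 = T.c0 := by
  simp only [c0, swap]; ring

lemma optE (Q1 : G.Walk T.s1 T.t1) (Q2 : G.Walk T.s2 T.t2) (l : List (Sym2 U))
    (h1 : ∀ e ∈ Q1.edges, e ∈ l) (h2 : ∀ e ∈ Q2.edges, e ∈ l) : T.c0 ≤ (l.map c).sum :=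
  T.opt Q1 Q2 l h1 h2

lemma I1 (Q1 : G.Walk T.s1 T.t1) (Q2 : G.Walk T.s2 T.t2) : T.c0 ≤ wc c Q1 + wc c Q2 := by
  have := T.optE Q1 Q2 (Q1.edges ++ Q2.edges) (by simp +contextual) (by simp +contextual)
  simpa [wc] using this

lemma LL {g i : ℕ} (hg : g ≤ T.k) (hi : i ≤ T.k) (r : G.Walk T.s1 (T.m g))
    (r' : G.Walk T.s2 (T.m i)) :
    wc c T.L1 + wc c T.L2 + T.C (min g i) ≤ wc c r + wc c r' := by
  obtain ⟨q, -, -, hq, -, hqe⟩ := T.seg (i := min g i) (j := T.k) (by omega) le_rfl rfl T.m_k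
  obtain ⟨q1, -, -, -, -, hq1⟩ := T.seg (i := g) (j := T.k) hg le_rfl rfl T.m_k
  obtain ⟨q2, -, -, -, -, hq2⟩ := T.seg (i := i) (j := T.k) hi le_rfl rfl T.m_k
  have := T.optE ((r.append q1).append T.R1) ((r'.append q2).append T.R2)
    (r.edges ++ (r'.edges ++ (q.edges ++ (T.R1.edges ++ T.R2.edges)))) ?_ ?_
  · simp only [List.map_append, List.sum_append] at this
    simp only [wc, c0] at *
    have h := T.C_k
    simp only [wc] at h
    linarith
  · intro e
    simp only [SimpleGraph.Walk.edges_append, List.mem_append, hq1, hqe]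
    rintro ((h | ⟨t, h1, h2, h3⟩) | h)
    · tauto
    · right; right; left; exact ⟨t, by omega, h2, h3⟩
    · tauto
  · intro e
    simp only [SimpleGraph.Walk.edges_append, List.mem_append, hq2, hqe]
    rintro ((h | ⟨t, h1, h2, h3⟩) | h)
    · tauto
    · right; right; left; exact ⟨t, by omega, h2, h3⟩
    · tauto

lemma RR {h j : ℕ} (hh : h ≤ T.k) (hj : j ≤ T.k) (r : G.Walk (T.m h) T.t1)
    (r' : G.Walk (T.m j) T.t2) :
    wc c T.R1 + wc c T.R2 + T.C T.k - T.C (max h j) ≤ wc c r + wc c r' := by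
  obtain ⟨q, -, -, hq, -, hqe⟩ := T.seg (i := 0) (j := max h j) (by omega) (by omega) T.m_zero rfl
  obtain ⟨q1, -, -, -, -, hq1⟩ := T.seg (i := 0) (j := h) (by omega) hh T.m_zero rfl
  obtain ⟨q2, -, -, -, -, hq2⟩ := T.seg (i := 0) (j := j) (by omega) hj T.m_zero rfl
  have := T.optE ((T.L1.append q1).append r) ((T.L2.append q2).append r')
    (r.edges ++ (r'.edges ++ (q.edges ++ (T.L1.edges ++ T.L2.edges)))) ?_ ?_
  · simp only [List.map_append, List.sum_append] at this
    simp only [wc, c0] at *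
    have h := T.C_k
    have h' := T.C_zero
    simp only [wc] at h
    linarith
  · intro e
    simp only [SimpleGraph.Walk.edges_append, List.mem_append, hq1, hqe]
    rintro ((h | ⟨t, h1, h2, h3⟩) | h)
    · tauto
    · right; right; left; exact ⟨t, by omega, by omega, h3⟩
    · tauto
  · intro e
    simp only [SimpleGraph.Walk.edges_append, List.mem_append, hq2, hqe]
    rintro ((h | ⟨t, h1, h2, h3⟩) | h)
    · tauto
    · right; right; left; exact ⟨t, by omega, by omega, h3⟩
    · tauto

lemma N {i j : ℕ} (hij : i ≤ j) (hj : j ≤ T.k) (r : G.Walk (T.m i) (T.m j)) :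
    T.C j - T.C i ≤ wc c r := by
  obtain ⟨q1, -, -, hq1, -, -⟩ := T.seg (i := 0) (j := i) (by omega) (by omega) T.m_zero rfl
  obtain ⟨q2, -, -, hq2, -, -⟩ := T.seg (i := j) (j := T.k) (by omega) (by omega) rfl T.m_k
  have := T.optE (((T.L1.append q1).append (r.append q2)).append T.R1)
    (((T.L2.append q1).append (r.append q2)).append T.R2)
    (r.edges ++ (q1.edges ++ (q2.edges ++ (T.L1.edges ++ (T.L2.edges ++ (T.R1.edges
      ++ T.R2.edges)))))) ?_ ?_
  · simp only [List.map_append, List.sum_append] at this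
    simp only [wc, c0] at *
    have h := T.C_k
    have h' := T.C_zero
    simp only [wc] at h
    linarith
  · intro e
    simp only [SimpleGraph.Walk.edges_append, List.mem_append]
    tauto
  · intro e
    simp only [SimpleGraph.Walk.edges_append, List.mem_append]
    tauto

lemma L2_le {i : ℕ} (hi : i ≤ T.k) (r : G.Walk T.s2 (T.m i)) : wc c T.L2 ≤ wc c r := by
  have := T.LL (g := 0) (by omega) hi (T.L1.copy rfl T.m_zero.symm) r
  have h' := T.C_zero
  simp [wc] at *
  linarith

lemma R2_le {j : ℕ} (hj : j ≤ T.k) (r : G.Walk (T.m j) T.t2) : wc c T.R2 ≤ wc c r := by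
  have := T.RR (h := T.k) le_rfl hj (T.R1.copy T.m_k.symm rfl) r
  rw [max_eq_left hj] at this
  simp [wc] at *
  linarith

end Cfg
end costs

section costs
variable {U : Type*} {G : SimpleGraph U}
namespace Cfg
variable {c : Sym2 U → ℝ} (T : Cfg G c)

/-- The irreducible situation for a pair of overlapping detours of player 2. -/
def Struct (T : Cfg G c) (z : ℝ) : Prop :=
  ∃ (l2 r2 : U) (L2' : G.Walk T.s2 l2) (R2' : G.Walk r2 T.t2) (x y : U) (W : G.Walk T.s2 y)
    (W' : G.Walk x T.t2), T.m 1 = x ∧ T.m (T.k - 1) = y ∧ 3 ≤ T.k ∧ wc c W + wc c W' ≤ z ∧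
    G.Adj l2 T.a ∧ G.Adj T.b r2 ∧ G.Adj l2 y ∧ G.Adj x r2 ∧ s(l2, y) ∈ W.edges ∧
    s(x, r2) ∈ W'.edges ∧ l2 ∈ T.L2.support ∧ r2 ∈ T.R2.support ∧
    wc c T.L2 = wc c L2' + c s(l2, T.a) ∧ wc c T.R2 = c s(T.b, r2) + wc c R2'

lemma Struct.mono {T : Cfg G c} {z z' : ℝ} (h : T.Struct z) (hz : z ≤ z') : T.Struct z' := by
  obtain ⟨l2, r2, L2', R2', x, y, W, W', h1, h2, h3, h4, h5⟩ := h
  exact ⟨l2, r2, L2', R2', x, y, W, W', h1, h2, h3, h4.trans hz, h5⟩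

lemma fake_hex {i j : ℕ} (W : G.Walk T.s2 (T.m i)) (W' : G.Walk (T.m j) T.t2) (hW : W.IsPath)
    (hW' : W'.IsPath) (hj : 1 ≤ j) (hji : j < i) (hi : i < T.k)
    (hWM : ∀ x ∈ W.support, x ∈ T.M.support → x = T.m i)
    (hWM' : ∀ x ∈ W'.support, x ∈ T.M.support → x = T.m j)
    (hWW : ∀ x ∈ W.support, x ∉ W'.support)
    (hWR : ∀ x ∈ W.support, x ∉ T.R2.support)
    (hWL : ∀ x ∈ W'.support, x ∉ T.L2.support) : T.Struct (wc c W + wc c W') := by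
  obtain ⟨l2, A, q2, hA, hl2, hq2⟩ := split_last W {x | x ∈ T.L2.support} (by simp)
  obtain ⟨r2, q3, A', hA', hr2, hq3⟩ := split_first W' {x | x ∈ T.R2.support} (by simp)
  simp only [Set.mem_ofPred_eq] at hl2 hr2 hq2 hq3
  obtain ⟨D, L'', hL''⟩ := split_at T.L2 hl2
  obtain ⟨R'', D', hR''⟩ := split_at T.R2 hr2
  have hab : T.a ≠ T.b := by
    intro h
    have := T.m_inj (i := 0) (j := T.k) (by omega) le_rfl (by rw [T.m_zero, T.m_k, h])
    omega
  have hWs : ∀ x ∈ q2.support, x ∈ W.support := by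
    intro x hx; rw [hA]; simp [SimpleGraph.Walk.mem_support_append_iff, hx]
  have hWs' : ∀ x ∈ q3.support, x ∈ W'.support := by
    intro x hx; rw [hA']; simp [SimpleGraph.Walk.mem_support_append_iff, hx]
  have hLs : ∀ x ∈ L''.support, x ∈ T.L2.support := by
    intro x hx; rw [hL'']; simp [SimpleGraph.Walk.mem_support_append_iff, hx]
  have hRs : ∀ x ∈ R''.support, x ∈ T.R2.support := by
    intro x hx; rw [hR'']; simp [SimpleGraph.Walk.mem_support_append_iff, hx]
  have haW : T.a ∉ W.support := by
    intro h
    have := hWM _ h (by simp)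
    have := T.m_inj (i := 0) (j := i) (by omega) hi.le (by rw [T.m_zero, this])
    omega
  have hbW' : T.b ∉ W'.support := by
    intro h
    have := hWM' _ h (by simp)
    have := T.m_inj (i := T.k) (j := j) (by omega) (by omega) (by rw [T.m_k, this])
    omega
  have hl2W : l2 ∈ W.support := hWs _ (by simp)
  have hr2W : r2 ∈ W'.support := hWs' _ (by simp)
  obtain ⟨p2, hp2, hp2l, -, hp2s, -⟩ := T.seg (i := i) (j := T.k) hi.le le_rfl rfl T.m_k
  obtain ⟨p5, hp5, hp5l, -, hp5s, -⟩ := T.seg (i := 0) (j := j) (by omega) (by omega) T.m_zero rfl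
  have hp2M : ∀ x ∈ p2.support, x ∈ T.M.support := by
    intro x hx
    obtain ⟨t, _, _, rfl⟩ := (hp2s x).1 hx
    exact T.m_mem
  have hp5M : ∀ x ∈ p5.support, x ∈ T.M.support := by
    intro x hx
    obtain ⟨t, _, _, rfl⟩ := (hp5s x).1 hx
    exact T.m_mem
  have hq2p : q2.IsPath := by rw [hA] at hW; exact hW.of_append_right
  have hq3p : q3.IsPath := by rw [hA'] at hW'; exact hW'.of_append_left
  have hLp : L''.IsPath := by have := T.pL2; rw [hL''] at this; exact this.of_append_right
  have hRp : R''.IsPath := by have := T.pR2; rw [hR''] at this; exact this.of_append_left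
  have hmim : T.m i ∈ W.support := by simp
  have hmjm : T.m j ∈ W'.support := by simp
  have l1 : 1 ≤ q2.length := by
    apply len_pos
    rintro h
    have := T.dLM2 hl2 (h ▸ T.m_mem)
    exact haW (this ▸ hl2W)
  have l3 : 1 ≤ R''.length := by
    apply len_pos
    rintro h
    exact hbW' (h ▸ hr2W)
  have l4 : 1 ≤ q3.length := by
    apply len_pos
    rintro h
    have := T.dMR2 (h ▸ T.m_mem) hr2 
    exact hbW' (this ▸ hr2W)
  have l6 : 1 ≤ L''.length := by
    apply len_pos
    rintro h
    exact haW (h ▸ hl2W)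
  have hb0 : T.a ∉ p2.support := by
    intro h
    obtain ⟨t, h1, h2, h3⟩ := (hp2s _).1 h
    have := T.m_inj (i := 0) (j := t) (by omega) h2 (by rw [T.m_zero, h3])
    omega
  have hb5 : T.b ∉ p5.support := by
    intro h
    obtain ⟨t, h1, h2, h3⟩ := (hp5s _).1 h
    have := T.m_inj (i := T.k) (j := t) (by omega) (by omega) (by rw [T.m_k, h3])
    omega
  have hmj2 : T.m j ∉ p2.support := by
    intro h
    obtain ⟨t, h1, h2, h3⟩ := (hp2s _).1 h
    have := T.m_inj (i := j) (j := t) (by omega) h2 h3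
    omega
  have hmi5 : T.m i ∉ p5.support := by
    intro h
    obtain ⟨t, h1, h2, h3⟩ := (hp5s _).1 h
    have := T.m_inj (i := i) (j := t) (by omega) (by omega) h3
    omega
  have h25 : ∀ x ∈ p2.support, x ∉ p5.support := by
    intro x hx hx'
    obtain ⟨t, h1, h2, rfl⟩ := (hp2s _).1 hx
    obtain ⟨t', h1', h2', h3⟩ := (hp5s _).1 hx'
    have := T.m_inj (i := t) (j := t') (by omega) (by omega) h3
    omega
  have hex := hexagon (p1 := q2) (p2 := p2) (p3 := R'') (p4 := q3.reverse) (p5 := p5.reverse)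
    (p6 := L''.reverse) hq2p hp2 hRp hq3p.reverse hp5.reverse hLp.reverse l1 (by omega)
    (fun x h1 h2 => hWM x (hWs x h1) (hp2M x h2))
    (fun x h1 h2 => T.dMR2 (hp2M x h1) (hRs x h2))
    (fun x h1 h2 => hq3 x (by simpa using h2) (hRs x h1))
    (fun x h1 h2 => hWM' x (hWs' x (by simpa using h1)) (hp5M x (by simpa using h2)))
    (fun x h1 h2 => T.dLM2 (hLs x (by simpa using h2)) (hp5M x (by simpa using h1)))
    (fun x h1 h2 => hq2 x h2 (hLs x (by simpa using h1)))
    (fun x h1 h2 => hWR x (hWs x h1) (hRs x h2))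
    (fun x h1 h2 => hWW x (hWs x h1) (hWs' x (by simpa using h2)))
    (fun x h1 h2 => hmi5 (by
      have h2' : x ∈ p5.support := by simpa using h2
      rwa [← hWM x (hWs x h1) (hp5M x h2')]))
    (fun x h1 h2 => hmj2 (by
      have h2' : x ∈ q3.support := by simpa using h2
      rwa [← hWM' x (hWs' x h2') (hp2M x h1)]))
    (fun x h1 h2 => h25 x h1 (by simpa using h2))
    (fun x h1 h2 => hb0 (by
      have h2' : x ∈ L''.support := by simpa using h2
      rwa [← T.dLM2 (hLs x h2') (hp2M x h1)]))
    (fun x h1 h2 => hb5 (by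
      have h2' : x ∈ p5.support := by simpa using h2
      rwa [← T.dMR2 (hp5M x h2') (hRs x h1)]))
    (fun x h1 h2 => hab (by
      have h2' : x ∈ L''.support := by simpa using h2
      have := T.dLR2 (hLs x h2') (hRs x h1)
      rw [← this.1, ← this.2]))
    (fun x h1 h2 => hWL x (hWs' x (by simpa using h1)) (hLs x (by simpa using h2)))
  obtain ⟨Cy, hCy, hlen, -⟩ := hex
  have h6 := T.circ _ Cy hCy
  simp only [SimpleGraph.Walk.length_reverse] at hlen
  obtain ⟨e1, e1'⟩ := len_one (p := q2) (by omega)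
  obtain ⟨e3, e3'⟩ := len_one (p := R'') (by omega)
  obtain ⟨e4, e4'⟩ := len_one (p := q3) (by omega)
  obtain ⟨e6, e6'⟩ := len_one (p := L'') (by omega)
  have hi1 : i = T.k - 1 := by omega
  have hj1 : j = 1 := by omega
  refine ⟨l2, r2, D, D', T.m j, T.m i, W, W', by rw [hj1], by rw [hi1], by omega, le_rfl, e6, e3,
    e1, e4, ?_, ?_, hl2, hr2, ?_, ?_⟩
  · rw [hA]; simp [e1']
  · rw [hA']; simp [e4']
  · rw [hL'', wc_append]; simp [wc, e6']
  · rw [hR'', wc_append]; simp [wc, e3']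

lemma fake_reduce (n : ℕ) : ∀ (i j : ℕ) (W : G.Walk T.s2 (T.m i)) (W' : G.Walk (T.m j) T.t2),
    W.length + W'.length ≤ n → j ≤ i → i ≤ T.k →
    (∃ Q : G.Walk T.s2 T.t2, wc c Q ≤ wc c W + wc c W') ∨ T.Struct (wc c W + wc c W') := by
  classical
  induction n using Nat.strong_induction_on with
  | _ n ih =>
  intro i j W0 W0' hn hji hi
  -- pass to paths
  suffices H : (∃ Q : G.Walk T.s2 T.t2, wc c Q ≤ wc c W0.bypass + wc c W0'.bypass) ∨
      T.Struct (wc c W0.bypass + wc c W0'.bypass) by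
    have h1 := wc_bypass T.hc W0
    have h2 := wc_bypass T.hc W0'
    rcases H with ⟨Q, hQ⟩ | H
    · left; exact ⟨Q, by linarith⟩
    · right; exact H.mono (by linarith)
  have hWp := W0.bypass_isPath
  have hWp' := W0'.bypass_isPath
  have hn' : W0.bypass.length + W0'.bypass.length ≤ n := by
    have := W0.length_bypass_le_length
    have := W0'.length_bypass_le_length
    omega
  generalize W0.bypass = W at *
  generalize W0'.bypass = W' at *
  clear hn W0 W0'
  by_cases hWW : ∃ x ∈ W.support, x ∈ W'.support
  · obtain ⟨x, h1, h2⟩ := hWW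
    obtain ⟨A, B, rfl⟩ := split_at W h1
    obtain ⟨A', B', rfl⟩ := split_at W' h2
    left
    refine ⟨A.append B', ?_⟩
    have := wc_nonneg T.hc B
    have := wc_nonneg T.hc A'
    simp only [wc_append]
    linarith
  push Not at hWW
  by_cases hWM : ∃ x ∈ W.support, x ∈ T.M.support ∧ x ≠ T.m i
  · obtain ⟨x, h1, h2, h3⟩ := hWM
    obtain ⟨i', hi', rfl⟩ := T.mem_M h2
    obtain ⟨A, B, rfl⟩ := split_at W h1
    have hB := len_pos B h3
    have hB0 := wc_nonneg T.hc B
    by_cases hji' : j ≤ i'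
    · have := ih (A.length + W'.length) (by simp at hn'; omega) i' j A W' le_rfl hji' hi'
      rcases this with ⟨Q, hQ⟩ | H
      · left; exact ⟨Q, by rw [wc_append]; linarith⟩
      · right; exact H.mono (by rw [wc_append]; linarith)
    · left
      obtain ⟨p, -, -, hp, -, -⟩ := T.seg (i := i') (j := j) (by omega) (by omega) rfl rfl
      refine ⟨(A.append p).append W', ?_⟩
      have hN := T.N (i := i') (j := i) (by omega) hi B
      have := T.C_mono hji
      simp only [wc_append]
      linarith
  push Not at hWM
  by_cases hWM' : ∃ x ∈ W'.support, x ∈ T.M.support ∧ x ≠ T.m j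
  · obtain ⟨x, h1, h2, h3⟩ := hWM'
    obtain ⟨j', hj', rfl⟩ := T.mem_M h2
    obtain ⟨A, B, rfl⟩ := split_at W' h1
    have hB := len_pos A h3.symm
    have hB0 := wc_nonneg T.hc A
    by_cases hji' : j' ≤ i
    · have := ih (W.length + B.length) (by simp at hn'; omega) i j' W B le_rfl hji' hi
      rcases this with ⟨Q, hQ⟩ | H
      · left; exact ⟨Q, by rw [wc_append]; linarith⟩
      · right; exact H.mono (by rw [wc_append]; linarith)
    · left
      obtain ⟨p, -, -, hp, -, -⟩ := T.seg (i := i) (j := j') (by omega) (by omega) rfl rfl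
      refine ⟨(W.append p).append B, ?_⟩
      have hN := T.N (i := j) (j := j') (by omega) hj' A
      have := T.C_mono hji
      simp only [wc_append]
      linarith
  push Not at hWM'
  have hL := T.L2_le hi W
  have hR := T.R2_le (by omega) W'
  by_cases hik : i = T.k
  · left
    refine ⟨W.append (T.R2.copy (by rw [hik, T.m_k]) rfl), ?_⟩
    rw [wc_append]
    simp only [wc, SimpleGraph.Walk.edges_copy] at *
    linarith
  by_cases hj0 : j = 0
  · left
    refine ⟨T.L2.append (W'.copy (by rw [hj0, T.m_zero]) rfl), ?_⟩
    rw [wc_append]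
    simp only [wc, SimpleGraph.Walk.edges_copy] at *
    linarith
  by_cases hWR : ∃ x ∈ W.support, x ∈ T.R2.support
  · obtain ⟨x, h1, h2⟩ := hWR
    obtain ⟨A, B, rfl⟩ := split_at W h1
    obtain ⟨A', B', h'⟩ := split_at T.R2 h2
    left
    refine ⟨A.append B', ?_⟩
    have := wc_nonneg T.hc B
    have := wc_nonneg T.hc A'
    rw [h'] at hR
    simp only [wc_append] at *
    linarith
  push Not at hWR
  by_cases hWL : ∃ x ∈ W'.support, x ∈ T.L2.support
  · obtain ⟨x, h1, h2⟩ := hWL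
    obtain ⟨A, B, rfl⟩ := split_at W' h1
    obtain ⟨A', B', h'⟩ := split_at T.L2 h2
    left
    refine ⟨A'.append B, ?_⟩
    have := wc_nonneg T.hc B'
    have := wc_nonneg T.hc A
    rw [h'] at hL
    simp only [wc_append] at *
    linarith
  push Not at hWL
  right
  have hij : j ≠ i := by
    rintro rfl
    exact hWW (T.m j) (by simp) (by simp)
  exact T.fake_hex W W' hWp hWp' (by omega) (by omega) (by omega) hWM hWM' hWW hWR hWL

end Cfg
end costs

section costs
variable {U : Type*} {G : SimpleGraph U}

lemma len_two {u v z : U} {p : G.Walk u v} (h : p.length = 2) (hz : z ∈ p.support) (h1 : z ≠ u)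
    (h2 : z ≠ v) : G.Adj u z ∧ s(u, z) ∈ p.edges := by
  cases p with
  | nil => simp at h
  | cons h' p =>
    cases p with
    | nil => simp at h
    | cons h'' p =>
      cases p with
      | nil =>
        simp at hz
        rcases hz with rfl | rfl | rfl
        · exact (h1 rfl).elim
        · exact ⟨h', by simp⟩
        · exact (h2 rfl).elim
      | cons _ _ => simp at h

namespace Cfg
variable {c : Sym2 U → ℝ} (T : Cfg G c)

lemma rev_k : T.rev.k = T.k := by simp [rev, k]
lemma rev_m (i : ℕ) : T.rev.m i = T.m (T.k - i) := by
  simp [rev, m, k, SimpleGraph.Walk.getVert_reverse]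
lemma rev_c0 : T.rev.c0 = T.c0 := by
  simp only [c0, rev, wc_reverse]; ring

lemma Struct.rev {T : Cfg G c} {z : ℝ} (h : T.Struct z) : T.rev.Struct z := by
  obtain ⟨l2, r2, L2', R2', x, y, W, W', h1, h2, h3, h4, h5, h6, h7, h8, h9, h10, h11, h12, h13,
    h14⟩ := h
  refine ⟨r2, l2, R2'.reverse, L2'.reverse, y, x, W'.reverse, W.reverse, ?_, ?_, ?_, ?_, h6.symm,
    h5.symm, h8.symm, h7.symm, ?_, ?_, ?_, ?_, ?_, ?_⟩
  · rw [rev_m, h2]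
  · rw [rev_m, rev_k, ← h1]; congr 1; omega
  · rw [rev_k]; exact h3
  · rw [wc_reverse, wc_reverse]; linarith
  · rw [Sym2.eq_swap]; simpa using h10
  · rw [Sym2.eq_swap]; simpa using h9
  · simpa [Cfg.rev] using h12
  · simpa [Cfg.rev] using h11
  · simp only [Cfg.rev, wc_reverse, h14]
    rw [Sym2.eq_swap (a := r2)]; ring
  · simp only [Cfg.rev, wc_reverse, h13]
    rw [Sym2.eq_swap (a := T.a)]; ring

set_option maxHeartbeats 1000000 in
lemma I2aux {z : ℝ} (hS : T.Struct z) (Q1 : G.Walk T.s1 T.t1) (hQ1 : Q1.IsPath)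
    (hav : ∀ i, 1 ≤ i → i ≤ T.k → T.m i ∉ Q1.support) : T.c0 ≤ wc c Q1 + z := by
  obtain ⟨l2, r2, L2', R2', x, y, W, W', hx, hy, hk, hz, hla, hbr, hly, hxr, hWe, hWe', hl2, hr2,
    hwL, hwR⟩ := hS
  have hab : T.a ≠ T.b := by
    intro h
    have := T.m_inj (i := 0) (j := T.k) (by omega) le_rfl (by rw [T.m_zero, T.m_k, h])
    omega
  have hbQ : T.b ∉ Q1.support := by
    have := hav T.k (by omega) le_rfl
    rwa [T.m_k] at this
  have hQM : ∀ v ∈ Q1.support, v ∈ T.M.support → v = T.a := by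
    intro v hv hvM
    obtain ⟨i, hi, rfl⟩ := T.mem_M hvM
    rcases Nat.eq_zero_or_pos i with rfl | h
    · exact T.m_zero
    · exact (hav i h hi hv).elim
  obtain ⟨r1, A, B, hAB, hr1, hA⟩ := split_first Q1 {x | x ∈ T.R1.support} (by simp)
  obtain ⟨l1, A0, q1, hA0, hl1, hq1⟩ := split_last A {x | x ∈ T.L1.support} (by simp)
  simp only [Set.mem_ofPred_eq] at hr1 hl1 hA hq1
  obtain ⟨D, X, hX⟩ := split_at T.L1 hl1
  obtain ⟨Y, D', hY⟩ := split_at T.R1 hr1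
  have hAs : ∀ v ∈ A.support, v ∈ Q1.support := by
    intro v hv; rw [hAB]; simp [SimpleGraph.Walk.mem_support_append_iff, hv]
  have hqA : ∀ v ∈ q1.support, v ∈ A.support := by
    intro v hv; rw [hA0]; simp [SimpleGraph.Walk.mem_support_append_iff, hv]
  have hXs : ∀ v ∈ X.support, v ∈ T.L1.support := by
    intro v hv; rw [hX]; simp [SimpleGraph.Walk.mem_support_append_iff, hv]
  have hYs : ∀ v ∈ Y.support, v ∈ T.R1.support := by
    intro v hv; rw [hY]; simp [SimpleGraph.Walk.mem_support_append_iff, hv]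
  have hXp : X.IsPath := by have := T.pL1; rw [hX] at this; exact this.of_append_right
  have hYp : Y.IsPath := by have := T.pR1; rw [hY] at this; exact this.of_append_left
  have hq1p : q1.IsPath := by
    rw [hAB] at hQ1
    have := hQ1.of_append_left
    rw [hA0] at this
    exact this.of_append_right
  have hr1A : r1 ∈ A.support := by simp
  have hYl : 1 ≤ Y.length := by
    apply len_pos
    rintro h
    exact hbQ (h ▸ hAs _ hr1A)
  have hq1l : 1 ≤ q1.length := by
    apply len_pos
    rintro rfl
    have := T.dLR1 hl1 hr1
    exact hab (this.1.symm.trans this.2)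
  have hXY : ∀ v, v ∈ X.support → v ∉ Y.support := by
    intro v h1 h2
    have := T.dLR1 (hXs v h1) (hYs v h2)
    exact hab (this.1.symm.trans this.2)
  have hk1 : (X.reverse.append q1).IsPath := by
    refine path_append hXp.reverse hq1p ?_
    intro v h1 h2
    exact hq1 v h2 (hXs v (by simpa using h1))
  have hQp : ((X.reverse.append q1).append Y.reverse).IsPath := by
    refine path_append hk1 hYp.reverse ?_
    intro v h1 h2
    have h2' : v ∈ Y.support := by simpa using h2
    rw [SimpleGraph.Walk.mem_support_append_iff] at h1
    rcases h1 with h1 | h1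
    · exact (hXY v (by simpa using h1) h2').elim
    · exact hA v (hqA v h1) (hYs v h2')
  have hQs : ∀ v, v ∈ ((X.reverse.append q1).append Y.reverse).support →
      v ∈ X.support ∨ v ∈ q1.support ∨ v ∈ Y.support := by
    intro v hv
    simp only [SimpleGraph.Walk.mem_support_append_iff, SimpleGraph.Walk.support_reverse,
      List.mem_reverse] at hv
    tauto
  have hQl : ((X.reverse.append q1).append Y.reverse).length = X.length + q1.length + Y.length := by
    simp
  generalize ((X.reverse.append q1).append Y.reverse) = Q at *
  have hQM' : ∀ v ∈ Q.support, v ∈ T.M.support → v = T.a ∨ v = T.b := by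
    intro v h1 h2
    rcases hQs v h1 with h | h | h
    · left; exact T.dLM1 (hXs v h) h2
    · left; exact hQM v (hAs v (hqA v h)) h2
    · right; exact T.dMR1 h2 (hYs v h)
  have hcyc : (Q.append T.M.reverse).IsCycle := by
    refine cyc_append hQp T.pM.reverse ?_ ?_
    · intro v h1 h2
      exact hQM' v h1 (by simpa using h2)
    · right; simp; change 1 < T.k; omega
  have h6 := T.circ _ _ hcyc
  have hkk : T.M.length = T.k := rfl
  simp only [SimpleGraph.Walk.length_append, SimpleGraph.Walk.length_reverse, hkk, hQl] at h6
  have hl2a : l2 ≠ T.a := hla.ne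
  have hr2b : r2 ≠ T.b := hbr.ne.symm
  have hl2M : l2 ∉ T.M.support := fun h => hl2a (T.dLM2 hl2 h)
  have hr2M : r2 ∉ T.M.support := fun h => hr2b (T.dMR2 h hr2)
  have hl2L : l2 ∉ T.L1.support := fun h => hl2a (T.dLL h hl2)
  have hl2R : l2 ∉ T.R1.support := fun h => hl2a (T.dL2R1 hl2 h).1
  have hr2L : r2 ∉ T.L1.support := fun h => hr2b (T.dL1R2 h hr2).2
  have hr2R : r2 ∉ T.R1.support := fun h => hr2b (T.dRR h hr2)
  have hl2r2 : l2 ≠ r2 := by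
    rintro rfl
    exact hl2a (T.dLR2 hl2 hr2).1
  -- the key vertex on q1
  have key : l2 ∈ q1.support ∨ r2 ∈ q1.support := by
    by_contra hcon
    push Not at hcon
    have hl2Q : l2 ∉ Q.support := by
      intro h
      rcases hQs _ h with h | h | h
      · exact hl2L (hXs _ h)
      · exact hcon.1 h
      · exact hl2R (hYs _ h)
    have hr2Q : r2 ∉ Q.support := by
      intro h
      rcases hQs _ h with h | h | h
      · exact hr2L (hXs _ h)
      · exact hcon.2 h
      · exact hr2R (hYs _ h)
    obtain ⟨p4, hp4, hp4l, -, hp4s, -⟩ := T.seg (i := 1) (j := T.k - 1) (by omega) (by omega) hx hy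
    have hp4M : ∀ v ∈ p4.support, v ∈ T.M.support := by
      intro v hv
      obtain ⟨t, _, _, rfl⟩ := (hp4s v).1 hv
      exact T.m_mem
    have ha4 : T.a ∉ p4.support := by
      intro h
      obtain ⟨t, h1, h2, h3⟩ := (hp4s _).1 h
      have := T.m_inj (i := 0) (j := t) (by omega) (by omega) (by rw [T.m_zero, h3])
      omega
    have hb4 : T.b ∉ p4.support := by
      intro h
      obtain ⟨t, h1, h2, h3⟩ := (hp4s _).1 h
      have := T.m_inj (i := T.k) (j := t) (by omega) (by omega) (by rw [T.m_k, h3])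
      omega
    have hQ4 : ∀ v, v ∈ Q.support → v ∉ p4.support := by
      intro v h1 h2
      rcases hQM' v h1 (hp4M v h2) with rfl | rfl
      · exact ha4 h2
      · exact hb4 h2
    have hx4 : x ∈ p4.support := by simp
    have hy4 : y ∈ p4.support := by simp
    have hxy : x ≠ y := by
      rintro rfl
      have := T.m_inj (i := 1) (j := T.k - 1) (by omega) (by omega) (by rw [hx, hy])
      omega
    have hl24 : l2 ∉ p4.support := fun h => hl2M (hp4M _ h)
    have hr24 : r2 ∉ p4.support := fun h => hr2M (hp4M _ h)
    have haM : T.a ∈ T.M.support := by simp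
    have hbM : T.b ∈ T.M.support := by simp
    have haQ : T.a ∈ Q.support := by simp
    have hbQ' : T.b ∈ Q.support := by simp
    have hex := hexagon (p1 := Q) (p2 := hbr.toWalk) (p3 := hxr.symm.toWalk) (p4 := p4)
      (p5 := hly.symm.toWalk) (p6 := hla.toWalk) hQp (by simp [hbr.ne])
      (by simp [hxr.ne.symm]) hp4 (by simp [hly.ne.symm]) (by simp [hla.ne]) 
      (by omega) (by simp)
      (by simp; grind) (by simp; grind) (by simp; grind) (by simp; grind) (by simp; grind)
      (by simp; grind) (by simp; grind) (by grind) (by simp; grind) (by simp; grind)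
      (by simp; grind) (by simp; grind) (by simp; grind) (by simp; grind) (by simp; grind)
    obtain ⟨Cy, hCy, hlen, -⟩ := hex
    have h6' := T.circ _ Cy hCy
    simp at hlen
    omega
  have hWl : wc c T.L2 ≤ wc c W := by
    subst hy
    exact T.L2_le (by omega) W
  have hWr : wc c T.R2 ≤ wc c W' := by
    subst hx
    exact T.R2_le (by omega) W'
  have hbound : ∀ z, z ∈ q1.support → z ≠ l1 → z ≠ r1 → l1 = T.a ∧ q1.length = 2 := by
    intro z hz h1 h2
    have : q1.length ≠ 1 := by
      intro h
      have hs := (len_one h).2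
      cases q1 with
      | nil => simp at h
      | cons h' p =>
        cases p with
        | nil => simp at hz; tauto
        | cons _ _ => simp at h
    exact ⟨len_zero (p := X) (by omega), by omega⟩
  have hQe : ∀ e ∈ q1.edges, e ∈ Q1.edges := by
    intro e he; rw [hAB, hA0]; simp [he]
  rcases key with hl | hr
  · obtain ⟨hl1a, h2⟩ := hbound l2 hl (by rintro rfl; exact hl2L hl1) (by rintro rfl; exact hl2R hr1)
    obtain ⟨-, he⟩ := len_two h2 hl (by rintro rfl; exact hl2L hl1) (by rintro rfl; exact hl2R hr1)
    have he' := hQe _ he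
    rw [hl1a] at he'
    obtain ⟨p, -, -, hp, -, hpe⟩ := T.seg (i := 0) (j := 1) (by omega) (by omega) T.m_zero hx
    obtain ⟨p', -, -, hp', -, hpe'⟩ := T.seg (i := T.k - 1) (j := T.k) (by omega) (by omega) hy T.m_k
    have e1 := T.optE Q1 ((L2'.append hla.toWalk).append (p.append W'))
      (Q1.edges ++ (L2'.edges ++ (p.edges ++ W'.edges))) (by simp +contextual) (by
        intro e
        simp only [SimpleGraph.Walk.edges_append, List.mem_append]
        rintro ((h | h) | h)
        · tauto
        · simp at h; subst h; rw [Sym2.eq_swap]; tauto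
        · tauto)
    have e2 := T.optE ((T.L1.append hla.symm.toWalk).append (hly.toWalk.append (p'.append T.R1)))
      (W.append (p'.append T.R2)) (T.L1.edges ++ (W.edges ++ ([s(l2, T.a)] ++ (p'.edges ++ (T.R1.edges
        ++ T.R2.edges)))))
      (by
        intro e
        simp only [SimpleGraph.Walk.edges_append, List.mem_append]
        rintro ((h | h) | (h | h))
        · tauto
        · simp at h; subst h; rw [Sym2.eq_swap]; simp
        · simp at h; subst h; tauto
        · tauto)
      (by
        intro e
        simp only [SimpleGraph.Walk.edges_append, List.mem_append]
        tauto)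
    have e1' : T.c0 ≤ wc c Q1 + (wc c L2' + (wc c p + wc c W')) := by
      simpa only [wc, List.map_append, List.sum_append] using e1
    have e2' : T.c0 ≤ wc c T.L1 + (wc c W + (c s(l2, T.a) + (wc c p' + (wc c T.R1 + wc c T.R2)))) := by
      simpa only [wc, List.map_append, List.sum_append, List.map_cons, List.map_nil, List.sum_cons,
        List.sum_nil, add_zero] using e2
    have h0 := T.C_zero
    have hk' := T.C_k
    have hm := T.C_mono (i := 1) (j := T.k - 1) (by omega)
    have h00 : T.c0 = wc c T.L1 + wc c T.R1 + wc c T.L2 + wc c T.R2 + wc c T.M := rfl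
    clear e1 e2
    linarith
  · obtain ⟨hl1a, h2⟩ := hbound r2 hr (by rintro rfl; exact hr2L hl1) (by rintro rfl; exact hr2R hr1)
    obtain ⟨had, he⟩ := len_two h2 hr (by rintro rfl; exact hr2L hl1) (by rintro rfl; exact hr2R hr1)
    have he' := hQe _ he
    rw [hl1a] at he' had
    have e1 := T.optE Q1 ((T.L2.append had.toWalk).append R2')
      (Q1.edges ++ (T.L2.edges ++ R2'.edges)) (by simp +contextual) (by
        intro e
        simp only [SimpleGraph.Walk.edges_append, List.mem_append]
        rintro ((h | h) | h)
        · tauto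
        · simp at h; subst h; tauto
        · tauto)
    have e1' : T.c0 ≤ wc c Q1 + (wc c T.L2 + wc c R2') := by
      simpa only [wc, List.map_append, List.sum_append] using e1
    have := T.hc s(T.b, r2)
    clear e1
    linarith

lemma I2s {z : ℝ} (hS : T.Struct z) (Q1 : G.Walk T.s1 T.t1) : T.c0 ≤ wc c Q1 + z := by
  classical
  suffices H : T.c0 ≤ wc c Q1.bypass + z by
    have := wc_bypass T.hc Q1
    linarith
  have hp := Q1.bypass_isPath
  generalize Q1.bypass = Q at *
  by_cases h1 : ∃ g, 1 ≤ g ∧ g < T.k ∧ T.m g ∈ Q.support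
  · obtain ⟨g, hg, hg', hm⟩ := h1
    obtain ⟨A, B, rfl⟩ := split_at Q hm
    obtain ⟨l2, r2, L2', R2', x, y, W, W', rfl, rfl, hk, hz, -⟩ := hS
    have e1 := T.LL hg'.le (by omega) A W
    have e2 := T.RR hg'.le (by omega) B W'
    rw [min_eq_left (by omega)] at e1
    rw [max_eq_left (by omega)] at e2
    have := T.C_k
    simp only [c0, wc_append] at *
    linarith
  push Not at h1
  by_cases hb : T.b ∈ Q.support
  · by_cases ha : T.a ∈ Q.support
    · have hQ : wc c T.L1 + wc c T.R1 + wc c T.M ≤ wc c Q := by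
        have : T.c0 ≤ wc c Q + (wc c T.L2 + wc c T.R2) := by
          obtain ⟨A, B, hAB⟩ := split_at Q ha
          have hE : ∀ e, e ∈ A.edges ∨ e ∈ B.edges → e ∈ Q.edges := by
            intro e he; rw [hAB]; simpa using he
          have hb' := hb
          rw [hAB, SimpleGraph.Walk.mem_support_append_iff] at hb'
          obtain ⟨S, hS⟩ : ∃ S : G.Walk T.a T.b, ∀ e ∈ S.edges, e ∈ Q.edges := by
            rcases hb' with h | h
            · obtain ⟨A1, A2, rfl⟩ := split_at A h
              refine ⟨A2.reverse, fun e he => hE e ?_⟩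
              left; simp at he; simp [he]
            · obtain ⟨A1, A2, rfl⟩ := split_at B h
              refine ⟨A1, fun e he => hE e ?_⟩
              right; simp [he]
          have := T.optE Q ((T.L2.append S).append T.R2) (Q.edges ++ (T.L2.edges ++ T.R2.edges))
            (by simp +contextual) (by
              intro e
              simp only [SimpleGraph.Walk.edges_append, List.mem_append]
              have := hS e
              tauto)
          simpa only [wc, List.map_append, List.sum_append] using this
        simp only [c0] at this
        linarith
      obtain ⟨l2, r2, L2', R2', x, y, W, W', rfl, rfl, hk, hz, -⟩ := hS
      have e1 := T.L2_le (by omega) W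
      have e2 := T.R2_le (by omega) W'
      simp only [c0]
      linarith
    · have := T.rev.I2aux hS.rev Q.reverse hp.reverse ?_
      · rw [rev_c0, wc_reverse] at this
        exact this
      · intro i hi hik
        rw [rev_k] at hik
        rw [rev_m]
        rw [SimpleGraph.Walk.support_reverse, List.mem_reverse]
        rcases Nat.eq_zero_or_pos (T.k - i) with h | h
        · rw [h, T.m_zero]; exact ha
        · exact h1 _ h (by omega)
  · refine T.I2aux hS Q hp ?_
    intro i hi hik
    rcases hik.eq_or_lt with rfl | h
    · rw [T.m_k]; exact hb
    · exact h1 _ hi h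

end Cfg
end costs

section costs
variable {U : Type*} {G : SimpleGraph U}
namespace Cfg
variable {c : Sym2 U → ℝ} (T : Cfg G c)

/-- Costs of the alternatives of player 2. -/
def Alt (T : Cfg G c) : Set ℝ := {z | (∃ Q : G.Walk T.s2 T.t2, z = wc c Q) ∨
  ∃ (i j : ℕ) (W : G.Walk T.s2 (T.m i)) (W' : G.Walk (T.m j) T.t2), j ≤ i ∧ i ≤ T.k ∧
    z = wc c W + wc c W'}

lemma alt_red {z : ℝ} (h : z ∈ T.Alt) : (∃ Q : G.Walk T.s2 T.t2, wc c Q ≤ z) ∨ T.Struct z := by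
  rcases h with ⟨Q, rfl⟩ | ⟨i, j, W, W', h1, h2, rfl⟩
  · exact Or.inl ⟨Q, le_rfl⟩
  · exact T.fake_reduce _ i j W W' le_rfl h1 h2

lemma alts {z z' : ℝ} (h : z ∈ T.Alt) (h' : z' ∈ T.swap.Alt) : T.c0 ≤ z + z' := by
  rcases T.alt_red h with ⟨Q, hQ⟩ | hS <;> rcases T.swap.alt_red h' with ⟨Q', hQ'⟩ | hS'
  · have := T.I1 Q' Q
    linarith
  · have := T.swap.I2s hS' Q
    rw [swap_c0] at this
    linarith
  · have := T.I2s hS Q'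
    linarith
  · obtain ⟨l2, r2, L2', R2', x, y, W, W', rfl, rfl, hk, hz, -⟩ := hS
    obtain ⟨Wtwo, Wthree, hz'⟩ : ∃ (Wtwo : G.Walk T.s1 (T.m (T.k - 1))) (Wthree : G.Walk (T.m 1) T.t1),
        wc c Wtwo + wc c Wthree ≤ z' := by
      obtain ⟨l2', r2', L2'', R2'', x', y', Wtwo, Wthree, rfl, rfl, hk', hz', -⟩ := hS'
      exact ⟨Wtwo, Wthree, hz'⟩
    have e1 := T.LL (g := T.k - 1) (i := T.k - 1) (by omega) (by omega) Wtwo W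
    have e2 := T.RR (h := 1) (j := 1) (by omega) (by omega) Wthree W'
    have := T.C_mono (i := 1) (j := T.k - 1) (by omega)
    have hk := T.C_k
    simp only [c0, min_self, max_self] at *
    linarith

/-- Potentials which make the path of player 1 a shortest path. -/
structure Good (T : Cfg G c) (y : ℕ → ℝ) : Prop where
  zero : y 0 = 0
  mono : ∀ i < T.k, y i ≤ y (i + 1)
  lip : ∀ i < T.k, y (i + 1) ≤ y i + c (T.E i)
  left : ∀ g ≤ T.k, ∀ r : G.Walk T.s1 (T.m g), wc c T.L1 + y g ≤ wc c r
  right : ∀ h ≤ T.k, ∀ r : G.Walk (T.m h) T.t1, y T.k - y h + wc c T.R1 ≤ wc c r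
  all : ∀ Q : G.Walk T.s1 T.t1, wc c T.L1 + y T.k + wc c T.R1 ≤ wc c Q

lemma exists_good : ∃ y : ℕ → ℝ, T.Good y ∧ T.swap.Good (fun i => T.C i - y i) := by
  have hC0 := T.C_zero
  have hCk := T.C_k
  obtain ⟨t, ht1, ht2⟩ := exists_between_of_forall_le
    (s := (fun z => T.C T.k - (z - wc c T.L2 - wc c T.R2)) '' T.Alt)
    (t := (fun z => z - wc c T.L1 - wc c T.R1) '' T.swap.Alt)
    ⟨_, _, Or.inl ⟨(T.L2.append T.M).append T.R2, rfl⟩, rfl⟩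
    ⟨_, _, Or.inl ⟨(T.L1.append T.M).append T.R1, rfl⟩, rfl⟩
    (by
      rintro _ ⟨z, hz, rfl⟩ _ ⟨z', hz', rfl⟩
      have := T.alts hz hz'
      simp only [c0] at this
      linarith)
  have hlow : ∀ z ∈ T.Alt, T.C T.k - (z - wc c T.L2 - wc c T.R2) ≤ t :=
    fun z hz => ht1 ⟨z, hz, rfl⟩
  have hup : ∀ z ∈ T.swap.Alt, t ≤ z - wc c T.L1 - wc c T.R1 :=
    fun z hz => ht2 ⟨z, hz, rfl⟩
  clear ht1 ht2
  set A : ℕ → Set ℝ := fun i => {z | (∃ i' ≤ i, ∃ r : G.Walk (T.m i') T.t1,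
      z = t + wc c T.R1 - wc c r) ∨
    (∃ i', i ≤ i' ∧ i' ≤ T.k ∧ ∃ r : G.Walk T.s2 (T.m i'), z = T.C i + wc c T.L2 - wc c r)} with hA
  -- upper bounds
  have U1 : ∀ g ≤ T.k, ∀ r : G.Walk T.s1 (T.m g), ∀ z ∈ A g, z ≤ wc c r - wc c T.L1 := by
    rintro g hg r z (⟨i', hi', r', rfl⟩ | ⟨i', hi', hi'', r', rfl⟩)
    · have := hup (wc c r + wc c r') (Or.inr ⟨g, i', r, r', hi', hg, rfl⟩)
      linarith
    · have := T.LL hg hi'' r r'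
      rw [min_eq_left hi'] at this
      linarith
  have U2 : ∀ j ≤ T.k, ∀ r : G.Walk (T.m j) T.t2, ∀ z ∈ A j,
      z ≤ wc c r + T.C j + t - T.C T.k - wc c T.R2 := by
    rintro j hj r z (⟨i', hi', r', rfl⟩ | ⟨i', hi', hi'', r', rfl⟩)
    · have := T.RR (by omega) hj r' r
      rw [max_eq_right hi'] at this
      linarith
    · have := hlow (wc c r' + wc c r) (Or.inr ⟨i', j, r', r, hi', hi'', rfl⟩)
      linarith
  have hne : ∀ i ≤ T.k, (A i).Nonempty := by
    intro i hi
    exact ⟨_, Or.inr ⟨T.k, hi, le_rfl, (T.L2.append T.M).copy rfl T.m_k.symm, rfl⟩⟩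
  have hL1 : ∀ i ≤ T.k, ∃ r : G.Walk T.s1 (T.m i), wc c r = wc c T.L1 + T.C i := by
    intro i hi
    obtain ⟨q, -, -, hq, -, -⟩ := T.seg (i := 0) (j := i) (by omega) hi T.m_zero rfl
    exact ⟨T.L1.append q, by rw [wc_append]; linarith⟩
  have hL2 : ∀ i ≤ T.k, ∃ r : G.Walk T.s2 (T.m i), wc c r = wc c T.L2 + T.C i := by
    intro i hi
    obtain ⟨q, -, -, hq, -, -⟩ := T.seg (i := 0) (j := i) (by omega) hi T.m_zero rfl
    exact ⟨T.L2.append q, by rw [wc_append]; linarith⟩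
  have hR1 : ∀ i ≤ T.k, ∃ r : G.Walk (T.m i) T.t1, wc c r = wc c T.R1 + T.C T.k - T.C i := by
    intro i hi
    obtain ⟨q, -, -, hq, -, -⟩ := T.seg (i := i) (j := T.k) (by omega) le_rfl rfl T.m_k
    exact ⟨q.append T.R1, by rw [wc_append]; linarith⟩
  have hR2 : ∀ i ≤ T.k, ∃ r : G.Walk (T.m i) T.t2, wc c r = wc c T.R2 + T.C T.k - T.C i := by
    intro i hi
    obtain ⟨q, -, -, hq, -, -⟩ := T.seg (i := i) (j := T.k) (by omega) le_rfl rfl T.m_k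
    exact ⟨q.append T.R2, by rw [wc_append]; linarith⟩
  have hbd : ∀ i ≤ T.k, BddAbove (A i) := by
    intro i hi
    obtain ⟨r, -⟩ := hL1 i hi
    exact ⟨_, fun z hz => U1 i hi r z hz⟩
  set y : ℕ → ℝ := fun i => sSup (A i) with hy
  have hle : ∀ i ≤ T.k, ∀ z ∈ A i, z ≤ y i := fun i hi z hz => le_csSup (hbd i hi) hz
  have hge : ∀ i ≤ T.k, ∀ b, (∀ z ∈ A i, z ≤ b) → y i ≤ b := fun i hi b hb => csSup_le (hne i hi) hb
  have y0 : y 0 = 0 := by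
    apply le_antisymm
    · obtain ⟨r, hr⟩ := hL1 0 (by omega)
      refine hge 0 (by omega) _ fun z hz => (U1 0 (by omega) r z hz).trans ?_
      linarith
    · obtain ⟨r, hr⟩ := hL2 0 (by omega)
      have := hle 0 (by omega) _ (Or.inr ⟨0, le_rfl, by omega, r, rfl⟩)
      linarith
  have yk : y T.k = t := by
    apply le_antisymm
    · obtain ⟨r, hr⟩ := hR2 T.k le_rfl
      refine hge T.k le_rfl _ fun z hz => (U2 T.k le_rfl r z hz).trans ?_
      linarith
    · obtain ⟨r, hr⟩ := hR1 T.k le_rfl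
      have := hle T.k le_rfl _ (Or.inl ⟨T.k, le_rfl, r, rfl⟩)
      linarith
  have ymono : ∀ i < T.k, y i ≤ y (i + 1) := by
    intro i hi
    refine hge i hi.le _ ?_
    rintro z (⟨i', hi', r', rfl⟩ | ⟨i', hi', hi'', r', rfl⟩)
    · exact hle (i + 1) hi _ (Or.inl ⟨i', by omega, r', rfl⟩)
    · have hcs := T.C_succ i
      have hc := T.hc (T.E i)
      rcases hi'.eq_or_lt with rfl | h
      · have := hle (i + 1) hi _ (Or.inr ⟨i + 1, le_rfl, hi, r'.append (T.adj_m hi).toWalk, rfl⟩)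
        rw [wc_append, SimpleGraph.Adj.toWalk, wc_cons, wc_nil] at this
        simp only [E] at *
        linarith
      · have := hle (i + 1) hi _ (Or.inr ⟨i', h, hi'', r', rfl⟩)
        linarith
  have ylip : ∀ i < T.k, y (i + 1) ≤ y i + c (T.E i) := by
    intro i hi
    have hcs := T.C_succ i
    have hc := T.hc (T.E i)
    refine hge (i + 1) hi _ ?_
    rintro z (⟨i', hi', r', rfl⟩ | ⟨i', hi', hi'', r', rfl⟩)
    · rcases hi'.eq_or_lt with rfl | h
      · have := hle i hi.le _ (Or.inl ⟨i, le_rfl, (T.adj_m hi).toWalk.append r', rfl⟩)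
        rw [wc_append, SimpleGraph.Adj.toWalk, wc_cons, wc_nil] at this
        simp only [E] at *
        linarith
      · have := hle i hi.le _ (Or.inl ⟨i', by omega, r', rfl⟩)
        linarith
    · have := hle i hi.le _ (Or.inr ⟨i', by omega, hi'', r', rfl⟩)
      linarith
  refine ⟨y, ⟨y0, ymono, ylip, ?_, ?_, ?_⟩, ⟨?_, ?_, ?_, ?_, ?_, ?_⟩⟩
  · intro g hg r
    have := hge g hg _ (U1 g hg r)
    linarith
  · intro h hh r
    have := hle h hh _ (Or.inl ⟨h, le_rfl, r, rfl⟩)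
    linarith
  · intro Q
    have := hup _ (Or.inl ⟨Q, rfl⟩)
    linarith
  · simp only [y0, hC0]; ring
  · intro i hi
    have := ylip i hi
    have := T.C_succ i
    change T.C i - y i ≤ T.C (i + 1) - y (i + 1)
    linarith
  · intro i hi
    have := ymono i hi
    have := T.C_succ i
    change T.C (i + 1) - y (i + 1) ≤ T.C i - y i + c (T.E i)
    linarith
  · intro g hg (r : G.Walk T.s2 (T.m g))
    have := hle g hg _ (Or.inr ⟨g, le_rfl, hg, r, rfl⟩)
    change wc c T.L2 + (T.C g - y g) ≤ wc c r
    linarith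
  · intro h hh (r : G.Walk (T.m h) T.t2)
    have := hge h hh _ (U2 h hh r)
    change (T.C T.k - y T.k) - (T.C h - y h) + wc c T.R2 ≤ wc c r
    linarith
  · intro Q
    have := hlow _ (Or.inl ⟨Q, rfl⟩)
    change wc c T.L2 + (T.C T.k - y T.k) + wc c T.R2 ≤ wc c Q
    linarith

lemma Good.mono' {T : Cfg G c} {y : ℕ → ℝ} (h : T.Good y) {i j : ℕ} (hij : i ≤ j) (hj : j ≤ T.k) :
    y i ≤ y j ∧ y j - y i ≤ T.C j - T.C i := by
  induction j, hij using Nat.le_induction with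
  | base => simp
  | succ n hn ih =>
    have h1 := ih (by omega)
    have h2 := h.mono n (by omega)
    have h3 := h.lip n (by omega)
    have h4 := T.C_succ n
    constructor <;> linarith

lemma Good.N' {T : Cfg G c} {y : ℕ → ℝ} (h : T.Good y) {i j : ℕ} (hi : i ≤ T.k) (hj : j ≤ T.k)
    (r : G.Walk (T.m i) (T.m j)) : y j - y i ≤ wc c r := by
  rcases le_total i j with hij | hij
  · have := T.N hij hj r
    have := (h.mono' hij hj).2
    linarith
  · have := (h.mono' hij hi).1
    have := wc_nonneg T.hc r
    linarith

lemma Good.dev {T : Cfg G c} {y : ℕ → ℝ} (h : T.Good y) (w : Sym2 U → ℝ)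
    (hw : ∀ i < T.k, w (T.E i) = y (i + 1) - y i) (hw' : ∀ e, e ∉ T.M.edges → w e = c e)
    {u z : U} (p : G.Walk u z) (hz : z = T.t1) :
    (∀ i ≤ T.k, ∀ r : G.Walk (T.m i) u, y T.k - y i + wc c T.R1 ≤ wc w p + wc c r) ∧
    (∀ r : G.Walk T.s1 u, wc c T.L1 + y T.k + wc c T.R1 ≤ wc w p + wc c r) := by
  induction p with
  | nil =>
    subst hz
    constructor
    · intro i hi r
      have := h.right i hi r
      rw [wc_nil]; linarith
    · intro r
      have := h.all r
      rw [wc_nil]; linarith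
  | @cons u v z hadj p ih =>
    obtain ⟨ih1, ih2⟩ := ih hz
    by_cases hM : s(u, v) ∈ T.M.edges
    · obtain ⟨j, hj, hE⟩ := (T.mem_M_edges _).1 hM
      have hwe := hw j hj
      have hm := h.mono j hj
      have hE' := hE
      rw [E, Sym2.eq_iff] at hE
      rcases hE with ⟨rfl, rfl⟩ | ⟨rfl, rfl⟩
      · have i1 := ih1 (j + 1) hj .nil
        rw [wc_nil] at i1
        constructor
        · intro i hi r
          have := h.N' hi hj.le r
          rw [wc_cons, hE', hwe]; linarith
        · intro r
          have := h.left j hj.le r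
          rw [wc_cons, hE', hwe]; linarith
      · have i1 := ih1 j hj.le .nil
        rw [wc_nil] at i1
        constructor
        · intro i hi r
          have := h.N' hi hj r
          rw [wc_cons, hE', hwe]; linarith
        · intro r
          have := h.left (j + 1) hj r
          rw [wc_cons, hE', hwe]; linarith
    · have hwe := hw' _ hM
      constructor
      · intro i hi r
        have := ih1 i hi (r.append hadj.toWalk)
        rw [wc_append, SimpleGraph.Adj.toWalk, wc_cons, wc_nil] at this
        rw [wc_cons, hwe]; linarith
      · intro r
        have := ih2 (r.append hadj.toWalk)
        rw [wc_append, SimpleGraph.Adj.toWalk, wc_cons, wc_nil] at this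
        rw [wc_cons, hwe]; linarith

lemma wc_congr {u v : U} {w w' : Sym2 U → ℝ} (p : G.Walk u v) (h : ∀ e ∈ p.edges, w e = w' e) :
    wc w p = wc w' p := by
  unfold wc
  rw [List.map_congr_left h]

/-- An edge outside the common part. -/
lemma L1_notM {e : Sym2 U} (he : e ∈ T.L1.edges) : e ∉ T.M.edges := by
  intro h
  have := T.hp1.of_append_left.isTrail.edges_nodup
  rw [SimpleGraph.Walk.edges_append, List.nodup_append'] at this
  exact this.2.2 he h

lemma R1_notM {e : Sym2 U} (he : e ∈ T.R1.edges) : e ∉ T.M.edges := by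
  intro h
  have := T.hp1.isTrail.edges_nodup
  rw [SimpleGraph.Walk.edges_append, List.nodup_append'] at this
  exact this.2.2 (by simp [h]) he

lemma Good.shortest {T : Cfg G c} {y : ℕ → ℝ} (h : T.Good y) (w : Sym2 U → ℝ)
    (hw : ∀ i < T.k, w (T.E i) = y (i + 1) - y i) (hw' : ∀ e, e ∉ T.M.edges → w e = c e)
    (Q : G.Walk T.s1 T.t1) : wc w ((T.L1.append T.M).append T.R1) ≤ wc w Q := by
  have h1 := (h.dev w hw hw' Q rfl).2 .nil
  have hM : wc w T.M = y T.k := by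
    rw [wc_eq_sum]
    have : ∀ n ≤ T.k, ∑ t ∈ Finset.range n, w s(T.M.getVert t, T.M.getVert (t + 1)) = y n := by
      intro n hn
      induction n with
      | zero => simp [h.zero]
      | succ n ih =>
        rw [Finset.sum_range_succ, ih (by omega)]
        have := hw n (by omega)
        change y n + w (T.E n) = _
        rw [this]; ring
    exact this _ le_rfl
  rw [wc_append, wc_append, hM, wc_congr T.L1 (fun e he => hw' e (T.L1_notM he)),
    wc_congr T.R1 (fun e he => hw' e (T.R1_notM he))]
  rw [wc_nil] at h1
  linarith

/-- Cost shares supporting the two paths. -/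
lemma core : ∃ x : Sym2 U → ℝ, (∀ e ∈ T.M.edges, 0 ≤ x e ∧ x e ≤ c e) ∧
    (∀ w : Sym2 U → ℝ, (∀ e ∈ T.M.edges, w e = x e) → (∀ e, e ∉ T.M.edges → w e = c e) →
      ∀ Q : G.Walk T.s1 T.t1, wc w ((T.L1.append T.M).append T.R1) ≤ wc w Q) ∧
    (∀ w : Sym2 U → ℝ, (∀ e ∈ T.M.edges, w e = c e - x e) → (∀ e, e ∉ T.M.edges → w e = c e) →
      ∀ Q : G.Walk T.s2 T.t2, wc w ((T.L2.append T.M).append T.R2) ≤ wc w Q) := by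
  classical
  obtain ⟨y, h1, h2⟩ := T.exists_good
  set x : Sym2 U → ℝ := fun e => if h : ∃ i < T.k, e = T.E i then y (h.choose + 1) - y h.choose
    else 0 with hx
  have hxE : ∀ i < T.k, x (T.E i) = y (i + 1) - y i := by
    intro i hi
    have h : ∃ i' < T.k, T.E i = T.E i' := ⟨i, hi, rfl⟩
    have e := T.E_inj hi h.choose_spec.1 h.choose_spec.2
    simp only [hx]
    rw [dif_pos h, ← e]
  refine ⟨x, ?_, ?_, ?_⟩
  · intro e he
    obtain ⟨i, hi, rfl⟩ := (T.mem_M_edges _).1 he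
    rw [hxE i hi]
    have := h1.mono i hi
    have := h1.lip i hi
    constructor <;> linarith
  · intro w hw hw' Q
    refine h1.shortest w ?_ hw' Q
    intro i hi
    rw [hw _ ((T.mem_M_edges _).2 ⟨i, hi, rfl⟩), hxE i hi]
  · intro w hw hw' Q
    refine h2.shortest w ?_ hw' Q
    intro i hi
    have h3 := hw _ ((T.mem_M_edges _).2 ⟨i, hi, rfl⟩)
    change w (T.E i) = _
    rw [h3, hxE i hi, T.C_succ]
    ring

end Cfg
end costs

section final
variable {U : Type*} {G : SimpleGraph U} {c : Sym2 U → ℝ}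

lemma sum_toFinset_le [DecidableEq U] (hc : ∀ e, 0 ≤ c e) (l : List (Sym2 U)) :
    ∑ e ∈ l.toFinset, c e ≤ (l.map c).sum := by
  induction l with
  | nil => simp
  | cons a l ih =>
    rw [List.toFinset_cons, List.map_cons, List.sum_cons]
    by_cases h : a ∈ l.toFinset
    · rw [Finset.insert_eq_of_mem h]
      have := hc a
      linarith
    · rw [Finset.sum_insert h]
      linarith

lemma opt_walks [DecidableEq U] (hc : ∀ e, 0 ≤ c e) {s₁ t₁ s₂ t₂ : U} {F : Finset (Sym2 U)}
    (hF : IsOptimalSteinerForest G s₁ t₁ s₂ t₂ c F) (Q1 : G.Walk s₁ t₁) (Q2 : G.Walk s₂ t₂)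
    (l : List (Sym2 U)) (h1 : ∀ e ∈ Q1.edges, e ∈ l) (h2 : ∀ e ∈ Q2.edges, e ∈ l) :
    cost c F ≤ (l.map c).sum := by
  classical
  set S : Set (Sym2 U) := {e | e ∈ Q1.edges ∨ e ∈ Q2.edges} with hS
  obtain ⟨F', hF', hac, hre⟩ := (SimpleGraph.fromEdgeSet S).exists_isAcyclic_reachable_eq_le
  have hSG : SimpleGraph.fromEdgeSet S ≤ G := by
    intro u v huv
    rw [SimpleGraph.fromEdgeSet_adj] at huv
    rcases huv.1 with h | h
    · exact Q1.edges_subset_edgeSet h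
    · exact Q2.edges_subset_edgeSet h
  have hF'S : ∀ e ∈ F'.edgeSet, e ∈ S := by
    intro e he
    have := SimpleGraph.edgeSet_mono hF' he
    rw [SimpleGraph.edgeSet_fromEdgeSet] at this
    exact this.1
  set X : Finset (Sym2 U) := l.toFinset.filter (fun e => e ∈ F'.edgeSet) with hX
  have hXF : (↑X : Set (Sym2 U)) = F'.edgeSet := by
    ext e
    simp only [hX, Finset.coe_filter, List.mem_toFinset, Set.mem_ofPred_eq]
    refine ⟨fun h => h.2, fun h => ⟨?_, h⟩⟩
    rcases hF'S e h with h | h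
    · exact h1 e h
    · exact h2 e h
  have key : ∀ {s t : U} (Q : G.Walk s t), (∀ e ∈ Q.edges, e ∈ S) →
      ∃ p : G.Walk s t, p.IsPath ∧ ∀ e ∈ p.edges, e ∈ X := by
    intro s t Q hQ
    have hQ' : ∀ e ∈ Q.edges, e ∈ (SimpleGraph.fromEdgeSet S).edgeSet := by
      intro e he
      rw [SimpleGraph.edgeSet_fromEdgeSet]
      exact ⟨hQ e he, fun hd => G.not_isDiag_of_mem_edgeSet (Q.edges_subset_edgeSet he) hd⟩
    have hr : F'.Reachable s t := by
      rw [hre]; exact ⟨Q.transfer _ hQ'⟩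
    obtain ⟨p, hp⟩ := hr.exists_isPath
    refine ⟨p.mapLe (hF'.trans hSG), (SimpleGraph.Walk.isPath_mapLe _).2 hp, ?_⟩
    intro e he
    rw [← Finset.mem_coe, hXF]
    rw [SimpleGraph.Walk.edges_mapLe_eq_edges] at he
    exact p.edges_subset_edgeSet he
  have hSt : IsSteinerForest G s₁ t₁ s₂ t₂ X := by
    refine ⟨?_, ?_, key Q1 (fun e he => Or.inl he), key Q2 (fun e he => Or.inr he)⟩
    · rw [hXF]; exact SimpleGraph.edgeSet_mono (hF'.trans hSG)
    · rw [hXF, SimpleGraph.fromEdgeSet_edgeSet]; exact hac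
  refine (hF.2 X hSt).trans (le_trans ?_ (sum_toFinset_le hc l))
  exact Finset.sum_le_sum_of_subset_of_nonneg (Finset.filter_subset _ _) (fun e _ _ => hc e)

/-- A separable protocol from shares of the doubly used edges. -/
lemma enforce [DecidableEq U] {s₁ t₁ s₂ t₂ : U} (hc : ∀ e, 0 ≤ c e) (P₁ : Strat G s₁ t₁)
    (P₂ : Strat G s₂ t₂) (σ : Sym2 U → ℝ) (h0 : ∀ e, 0 ≤ σ e) (h1 : ∀ e, σ e ≤ c e)
    (H1 : ∀ Q : G.Walk s₁ t₁, wc (fun e => if e ∈ P₂.1.edges then σ e else c e) P₁.1 ≤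
      wc (fun e => if e ∈ P₂.1.edges then σ e else c e) Q)
    (H2 : ∀ Q : G.Walk s₂ t₂, wc (fun e => if e ∈ P₁.1.edges then c e - σ e else c e) P₂.1 ≤
      wc (fun e => if e ∈ P₁.1.edges then c e - σ e else c e) Q) :
    ∃ Ξ : Protocol G s₁ t₁ s₂ t₂, IsSeparable c Ξ ∧ IsPNE Ξ P₁ P₂ := by
  classical
  set Ξ : Protocol G s₁ t₁ s₂ t₂ := fun Q₁ Q₂ i e =>
    if (usedBy Q₁ Q₂ e) = {0, 1} then (if i = 0 then σ e else c e - σ e) else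
      (if i ∈ usedBy Q₁ Q₂ e then c e else 0) with hΞ
  have hu0 : ∀ (Q₁ : Strat G s₁ t₁) (Q₂ : Strat G s₂ t₂) e, e ∈ Q₁.1.edges →
      Ξ Q₁ Q₂ 0 e = if e ∈ Q₂.1.edges then σ e else c e := by
    intro Q₁ Q₂ e he
    by_cases h : e ∈ Q₂.1.edges
    · simp [hΞ, usedBy, he, h]
    · have : ({0} : Finset (Fin 2)) ≠ {0, 1} := by decide
      simp [hΞ, usedBy, he, h]
      intro h'; exact (this h').elim
  have hu1 : ∀ (Q₁ : Strat G s₁ t₁) (Q₂ : Strat G s₂ t₂) e, e ∈ Q₂.1.edges →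
      Ξ Q₁ Q₂ 1 e = if e ∈ Q₁.1.edges then c e - σ e else c e := by
    intro Q₁ Q₂ e he
    by_cases h : e ∈ Q₁.1.edges
    · simp [hΞ, usedBy, he, h]
    · have : ({1} : Finset (Fin 2)) ≠ {0, 1} := by decide
      simp [hΞ, usedBy, he, h]
      intro h'; exact (this h').elim
  have hsum : ∀ {s t : U} (Q : Strat G s t) (w : Sym2 U → ℝ),
      ∑ e ∈ Q.1.edges.toFinset, w e = wc w Q.1 := by
    intro s t Q w
    exact List.sum_toFinset _ Q.2.isTrail.edges_nodup
  have hc1 : ∀ Q₁ Q₂, cost₁ Ξ Q₁ Q₂ = wc (fun e => if e ∈ Q₂.1.edges then σ e else c e) Q₁.1 := by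
    intro Q₁ Q₂
    rw [← hsum]
    exact Finset.sum_congr rfl fun e he => hu0 Q₁ Q₂ e (List.mem_toFinset.1 he)
  have hc2 : ∀ Q₁ Q₂, cost₂ Ξ Q₁ Q₂ =
      wc (fun e => if e ∈ Q₁.1.edges then c e - σ e else c e) Q₂.1 := by
    intro Q₁ Q₂
    rw [← hsum]
    exact Finset.sum_congr rfl fun e he => hu1 Q₁ Q₂ e (List.mem_toFinset.1 he)
  have hP : IsPNE Ξ P₁ P₂ := by
    constructor
    · intro Q; rw [hc1, hc1]; exact H1 Q.1
    · intro Q; rw [hc2, hc2]; exact H2 Q.1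
  refine ⟨Ξ, ⟨?_, ?_, ⟨P₁, P₂, hP⟩, ?_⟩, hP⟩
  · intro Q₁ Q₂ i e
    have := h0 e
    have := h1 e
    have := hc e
    simp only [hΞ]
    split_ifs <;> linarith
  · intro Q₁ Q₂ e hne
    by_cases a1 : e ∈ Q₁.1.edges <;> by_cases a2 : e ∈ Q₂.1.edges
    · have : usedBy Q₁ Q₂ e = {0, 1} := by simp [usedBy, a1, a2]
      rw [this, Finset.sum_pair (by decide), hu0 _ _ _ a1, hu1 _ _ _ a2, if_pos a1, if_pos a2]
      ring
    · have : usedBy Q₁ Q₂ e = {0} := by simp [usedBy, a1, a2]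
      rw [this, Finset.sum_singleton, hu0 _ _ _ a1, if_neg a2]
    · have : usedBy Q₁ Q₂ e = {1} := by simp [usedBy, a1, a2]
      rw [this, Finset.sum_singleton, hu1 _ _ _ a2, if_neg a1]
    · simp [usedBy, a1, a2] at hne
  · intro Q₁ Q₂ Q₁' Q₂' e h i
    simp only [hΞ, h]

/-- Shares for two paths with a consistently oriented common part. -/
lemma shares_cfg [DecidableEq U] (T : Cfg G c) : ∃ σ : Sym2 U → ℝ, (∀ e, 0 ≤ σ e) ∧
    (∀ e, σ e ≤ c e) ∧
    (∀ Q : G.Walk T.s1 T.t1,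
      wc (fun e => if e ∈ ((T.L2.append T.M).append T.R2).edges then σ e else c e)
        ((T.L1.append T.M).append T.R1) ≤
      wc (fun e => if e ∈ ((T.L2.append T.M).append T.R2).edges then σ e else c e) Q) ∧
    (∀ Q : G.Walk T.s2 T.t2,
      wc (fun e => if e ∈ ((T.L1.append T.M).append T.R1).edges then c e - σ e else c e)
        ((T.L2.append T.M).append T.R2) ≤
      wc (fun e => if e ∈ ((T.L1.append T.M).append T.R1).edges then c e - σ e else c e) Q) := by
  obtain ⟨x, hx, H1, H2⟩ := T.core
  have hE : ∀ e, e ∈ ((T.L1.append T.M).append T.R1).edges →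
      e ∈ ((T.L2.append T.M).append T.R2).edges → e ∈ T.M.edges := by
    intro e
    simp only [SimpleGraph.Walk.edges_append, List.mem_append]
    rintro ((h | h) | h) ((h' | h') | h') <;> try assumption
    all_goals
      exfalso
      induction e using Sym2.ind with
      | _ u v =>
      have hne : u ≠ v := by
        rintro rfl
        first
        | exact G.loopless.irrefl _ (T.L1.edges_subset_edgeSet h)
        | exact G.loopless.irrefl _ (T.R1.edges_subset_edgeSet h)
      have e1 := edge_supp h
      have e2 := edge_supp h'
      apply hne
      first
      | exact (T.dLL e1.1 e2.1).trans (T.dLL e1.2 e2.2).symm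
      | exact (T.dL1R2 e1.1 e2.1).1.trans (T.dL1R2 e1.2 e2.2).1.symm
      | exact (T.dL2R1 e2.1 e1.1).1.trans (T.dL2R1 e2.2 e1.2).1.symm
      | exact (T.dRR e1.1 e2.1).trans (T.dRR e1.2 e2.2).symm
  have hM1 : ∀ e ∈ T.M.edges, e ∈ ((T.L1.append T.M).append T.R1).edges := by
    intro e he; simp [he]
  have hM2 : ∀ e ∈ T.M.edges, e ∈ ((T.L2.append T.M).append T.R2).edges := by
    intro e he; simp [he]
  refine ⟨fun e => if e ∈ T.M.edges then x e else
    if e ∈ ((T.L2.append T.M).append T.R2).edges then c e else 0, ?_, ?_, ?_, ?_⟩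
  · intro e
    have := T.hc e
    dsimp only
    split_ifs with h
    · exact (hx e h).1
    · exact this
    · exact le_rfl
  · intro e
    have := T.hc e
    dsimp only
    split_ifs with h
    · exact (hx e h).2
    · exact le_rfl
    · exact this
  · apply H1
    · intro e he
      dsimp only
      rw [if_pos (hM2 e he), if_pos he]
    · intro e he
      dsimp only
      rw [if_neg he]
      split_ifs <;> rfl
  · apply H2
    · intro e he
      dsimp only
      rw [if_pos (hM1 e he), if_pos he]
    · intro e he
      dsimp only
      rw [if_neg he]
      split_ifs with h1 h2
      · exact (he (hE e h1 h2)).elim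
      · ring
      · rfl

end final

section final2
variable {U : Type*} {G : SimpleGraph U} {c : Sym2 U → ℝ}

lemma nodup_le [DecidableEq U] (hc : ∀ e, 0 ≤ c e) {F : Finset (Sym2 U)} {l : List (Sym2 U)}
    (hl : l.Nodup) (hF : ∀ e ∈ l, e ∈ F) : (l.map c).sum ≤ cost c F := by
  rw [← List.sum_toFinset c hl]
  refine Finset.sum_le_sum_of_subset_of_nonneg ?_ (fun e _ _ => hc e)
  intro e he
  exact hF e (List.mem_toFinset.1 he)

lemma edges_disj {u v u' v' : U} {p : G.Walk u v} {q : G.Walk u' v'} {z : U}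
    (h : ∀ x, x ∈ p.support → x ∈ q.support → x = z) {e : Sym2 U} (h1 : e ∈ p.edges)
    (h2 : e ∈ q.edges) : False := by
  induction e using Sym2.ind with
  | _ s t =>
  have hne : s ≠ t := by
    rintro rfl
    exact G.loopless.irrefl _ (p.edges_subset_edgeSet h1)
  have e1 := edge_supp h1
  have e2 := edge_supp h2
  exact hne ((h s e1.1 e2.1).trans (h t e1.2 e2.2).symm)

/-- The claim about cost shares for two paths. -/
def SharesFor [DecidableEq U] (c : Sym2 U → ℝ) {s₁ t₁ s₂ t₂ : U} (P₁ : G.Walk s₁ t₁)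
    (P₂ : G.Walk s₂ t₂) : Prop :=
  ∃ σ : Sym2 U → ℝ, (∀ e, 0 ≤ σ e) ∧ (∀ e, σ e ≤ c e) ∧
    (∀ Q : G.Walk s₁ t₁, wc (fun e => if e ∈ P₂.edges then σ e else c e) P₁ ≤
      wc (fun e => if e ∈ P₂.edges then σ e else c e) Q) ∧
    (∀ Q : G.Walk s₂ t₂, wc (fun e => if e ∈ P₁.edges then c e - σ e else c e) P₂ ≤
      wc (fun e => if e ∈ P₁.edges then c e - σ e else c e) Q)

lemma shares_oriented [DecidableEq U] (hc : ∀ e, 0 ≤ c e)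
    (circ : ∀ (y : U) (p : G.Walk y y), p.IsCycle → p.length ≤ 6)
    {F : Finset (Sym2 U)} {s₁ t₁ s₂ t₂ a b : U} {L1 : G.Walk s₁ a} {M : G.Walk a b}
    {R1 : G.Walk b t₁} {L2 : G.Walk s₂ a} {R2 : G.Walk b t₂}
    (hp1 : ((L1.append M).append R1).IsPath) (hp2 : ((L2.append M).append R2).IsPath)
    (hmeet : ∀ x, x ∈ ((L1.append M).append R1).support →
      x ∈ ((L2.append M).append R2).support → x ∈ M.support)
    (hF1 : ∀ e ∈ ((L1.append M).append R1).edges, e ∈ F)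
    (hF2 : ∀ e ∈ ((L2.append M).append R2).edges, e ∈ F)
    (opt : ∀ (Q1 : G.Walk s₁ t₁) (Q2 : G.Walk s₂ t₂) (l : List (Sym2 U)),
      (∀ e ∈ Q1.edges, e ∈ l) → (∀ e ∈ Q2.edges, e ∈ l) → cost c F ≤ (l.map c).sum) :
    SharesFor c ((L1.append M).append R1) ((L2.append M).append R2) := by
  have hnd : (((L1.append M).append R1).edges ++ (L2.edges ++ R2.edges)).Nodup := by
    have n1 := hp1.isTrail.edges_nodup
    have n2 := hp2.isTrail.edges_nodup
    rw [SimpleGraph.Walk.edges_append, SimpleGraph.Walk.edges_append] at n2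
    rw [List.nodup_append'] at n2
    have n3 := List.nodup_append'.1 n2.1
    rw [List.nodup_append', List.nodup_append']
    refine ⟨n1, ⟨n3.1, n2.2.1, ?_⟩, ?_⟩
    · intro e h1 h2
      exact n2.2.2 (List.mem_append_left _ h1) h2
    · intro e h1 h2
      rcases List.mem_append.1 h2 with h2 | h2
      · refine edges_disj (z := a) ?_ h1 h2
        intro x hx hx'
        refine append_disj hp2.of_append_left hx' (hmeet x hx ?_)
        simp [SimpleGraph.Walk.mem_support_append_iff, hx']
      · refine edges_disj (z := b) ?_ h1 h2
        intro x hx hx'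
        refine append_disj hp2 (?_ : x ∈ (L2.append M).support) hx'
        have := hmeet x hx (by simp [SimpleGraph.Walk.mem_support_append_iff, hx'])
        simp [SimpleGraph.Walk.mem_support_append_iff, this]
  have hle := nodup_le (F := F) hc hnd (by
    intro e he
    rcases List.mem_append.1 he with h | h
    · exact hF1 e h
    · apply hF2
      simp only [SimpleGraph.Walk.edges_append, List.mem_append] at h ⊢
      tauto)
  exact shares_cfg (c := c) ⟨s₁, t₁, s₂, t₂, a, b, L1, M, R1, L2, R2, hc, hp1, hp2, hmeet, by
    intro Q1 Q2 l h1 h2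
    refine le_trans (le_trans ?_ hle) (opt Q1 Q2 l h1 h2)
    simp only [wc, SimpleGraph.Walk.edges_append, List.map_append, List.sum_append]
    linarith, circ⟩

lemma shares_all [DecidableEq U] (hc : ∀ e, 0 ≤ c e)
    (circ : ∀ (y : U) (p : G.Walk y y), p.IsCycle → p.length ≤ 6)
    {F : Finset (Sym2 U)} {s₁ t₁ s₂ t₂ : U} (P₁ : G.Walk s₁ t₁) (P₂ : G.Walk s₂ t₂)
    (hp1 : P₁.IsPath) (hp2 : P₂.IsPath)
    (hac : (SimpleGraph.fromEdgeSet (↑F : Set (Sym2 U))).IsAcyclic)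
    (hF1 : ∀ e ∈ P₁.edges, e ∈ F) (hF2 : ∀ e ∈ P₂.edges, e ∈ F)
    (opt : ∀ (Q1 : G.Walk s₁ t₁) (Q2 : G.Walk s₂ t₂) (l : List (Sym2 U)),
      (∀ e ∈ Q1.edges, e ∈ l) → (∀ e ∈ Q2.edges, e ∈ l) → cost c F ≤ (l.map c).sum) :
    SharesFor c P₁ P₂ := by
  by_cases hsh : ∃ x, x ∈ P₁.support ∧ x ∈ P₂.support
  · obtain ⟨x, hx1, hx2⟩ := hsh
    obtain ⟨X, Y, rfl⟩ := split_at P₁ hx1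
    obtain ⟨a, L1, M1, rfl, ha, hL⟩ := split_first X {z | z ∈ P₂.support} hx2
    obtain ⟨b, M2, R1, rfl, hb, hR⟩ := split_last Y {z | z ∈ P₂.support} hx2
    have hre : (L1.append M1).append (M2.append R1) = (L1.append (M1.append M2)).append R1 := by
      simp only [SimpleGraph.Walk.append_assoc]
    rw [hre] at hp1 hF1 ⊢
    clear hx1 hre
    obtain ⟨M, hM⟩ : ∃ M, M = M1.append M2 := ⟨_, rfl⟩
    rw [← hM] at hp1 hF1 ⊢
    have hpM : M.IsPath := hp1.of_append_left.of_append_right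
    have hFM : ∀ e ∈ M.edges, e ∈ (↑F : Set (Sym2 U)) := by
      intro e he; exact hF1 e (by simp [he])
    have hmeet : ∀ x, x ∈ ((L1.append M).append R1).support → x ∈ P₂.support → x ∈ M.support := by
      intro y hy hy2
      simp only [SimpleGraph.Walk.mem_support_append_iff] at hy
      rcases hy with (h | h) | h
      · rw [hL y h hy2]; exact M.start_mem_support
      · exact h
      · rw [hR y h hy2]; exact M.end_mem_support
    obtain ⟨X2, Y2, rfl⟩ := split_at P₂ ha
    rcases (SimpleGraph.Walk.mem_support_append_iff _ _).1 hb with hb' | hb'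
    · obtain ⟨L, N, rfl⟩ := split_at X2 hb'
      have hN : N.reverse = M := by
        refine forest_unique hac (hp2.of_append_left.of_append_right.reverse) hpM ?_ hFM
        intro e he
        rw [SimpleGraph.Walk.edges_reverse, List.mem_reverse] at he
        exact hF2 e (by simp [he])
      have hrev : ((L.append N).append Y2).reverse = (Y2.reverse.append M).append L.reverse := by
        rw [← hN]; simp [SimpleGraph.Walk.reverse_append, SimpleGraph.Walk.append_assoc]
      have hed : ∀ e, e ∈ ((Y2.reverse.append M).append L.reverse).edges ↔
          e ∈ ((L.append N).append Y2).edges := by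
        intro e; rw [← hrev, SimpleGraph.Walk.edges_reverse, List.mem_reverse]
      have hsu : ∀ e, e ∈ ((Y2.reverse.append M).append L.reverse).support ↔
          e ∈ ((L.append N).append Y2).support := by
        intro e; rw [← hrev, SimpleGraph.Walk.support_reverse, List.mem_reverse]
      obtain ⟨σ, s0, s1, sA, sB⟩ := shares_oriented (L1 := L1) (M := M) (R1 := R1)
        (L2 := Y2.reverse) (R2 := L.reverse) (F := F) hc circ hp1 (by rw [← hrev]; exact hp2.reverse)
        (fun y h1 h2 => hmeet y h1 ((hsu y).1 h2)) hF1 (fun e he => hF2 e ((hed e).1 he))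
        (fun Q1 Q2 l h1 h2 => opt Q1 Q2.reverse l h1 (by simpa using h2))
      refine ⟨σ, s0, s1, ?_, ?_⟩
      · simpa only [hed] using sA
      · intro Q
        have := sB Q.reverse
        rw [← hrev, wc_reverse, wc_reverse] at this
        exact this
    · obtain ⟨N, R, rfl⟩ := split_at Y2 hb'
      have hN : N = M := by
        refine forest_unique hac (hp2.of_append_right.of_append_left) hpM ?_ hFM
        intro e he
        exact hF2 e (by simp [he])
      subst hN
      have hre : X2.append (N.append R) = (X2.append N).append R := by
        simp only [SimpleGraph.Walk.append_assoc]
      rw [hre] at hp2 hF2 hmeet ⊢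
      exact shares_oriented hc circ hp1 hp2 hmeet hF1 hF2 opt
  · have hdis : ∀ e, e ∈ P₁.edges → e ∈ P₂.edges → False := by
      intro e h1 h2
      exact edges_disj (z := s₁) (fun x hx hx' => (hsh ⟨x, hx, hx'⟩).elim) h1 h2
    have hle := nodup_le (F := F) (l := P₁.edges ++ P₂.edges) hc
      (List.nodup_append'.2 ⟨hp1.isTrail.edges_nodup, hp2.isTrail.edges_nodup,
        fun e h1 h2 => hdis e h1 h2⟩)
      (by intro e he
          rcases List.mem_append.1 he with h | h
          · exact hF1 e h
          · exact hF2 e h)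
    rw [List.map_append, List.sum_append] at hle
    refine ⟨fun e => if e ∈ P₂.edges then c e else 0, ?_, ?_, ?_, ?_⟩
    · intro e; dsimp only; split_ifs
      · exact hc e
      · exact le_rfl
    · intro e; dsimp only; split_ifs
      · exact le_rfl
      · exact hc e
    · intro Q
      have h : (fun e => if e ∈ P₂.edges then (if e ∈ P₂.edges then c e else 0) else c e) = c := by
        funext e; split_ifs <;> rfl
      simp only [h]
      have := opt Q P₂ (Q.edges ++ P₂.edges) (by simp +contextual) (by simp +contextual)
      rw [List.map_append, List.sum_append] at this
      simp only [wc]; linarith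
    · intro Q
      have h : (fun e => if e ∈ P₁.edges then c e - (if e ∈ P₂.edges then c e else 0) else c e)
          = c := by
        funext e; split_ifs with h1 h2
        · exact (hdis e h1 h2).elim
        · ring
        · rfl
      simp only [h]
      have := opt P₁ Q (P₁.edges ++ Q.edges) (by simp +contextual) (by simp +contextual)
      rw [List.map_append, List.sum_append] at this
      simp only [wc]; linarith

lemma part_two [DecidableEq U] (circ : ∀ (y : U) (p : G.Walk y y), p.IsCycle → p.length ≤ 6)
    (s₁ t₁ s₂ t₂ : U) : StronglyEfficient G s₁ t₁ s₂ t₂ := by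
  intro c hc F hF
  obtain ⟨⟨-, hac, ⟨P₁, hp1, hF1⟩, ⟨P₂, hp2, hF2⟩⟩, -⟩ := id hF
  obtain ⟨σ, h0, h1, A, B⟩ := shares_all hc circ P₁ P₂ hp1 hp2 hac hF1 hF2
    (fun Q1 Q2 l => opt_walks hc hF Q1 Q2 l)
  refine ⟨⟨P₁, hp1⟩, ⟨P₂, hp2⟩, hF1, hF2, ?_, ?_, enforce hc ⟨P₁, hp1⟩ ⟨P₂, hp2⟩ σ h0 h1 A B⟩
  · intro Q hQ
    exact Subtype.ext (forest_unique hac Q.2 hp1 hQ hF1)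
  · intro Q hQ
    exact Subtype.ext (forest_unique hac Q.2 hp2 hQ hF2)

end final2

section bcidx
variable {U : Type*} {G : SimpleGraph U}

lemma edge_inj {u v : U} {P : G.Walk u v} (hP : P.IsPath) {s t : ℕ} (hs : s < P.length)
    (ht : t < P.length)
    (h : s(P.getVert s, P.getVert (s + 1)) = s(P.getVert t, P.getVert (t + 1))) : s = t := by
  have inj : ∀ {i j : ℕ}, i ≤ P.length → j ≤ P.length → P.getVert i = P.getVert j → i = j :=
    fun hi hj h => hP.getVert_injOn hi hj h
  rcases Sym2.eq_iff.1 h with ⟨h1, -⟩ | ⟨h1, h2⟩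
  · exact inj hs.le ht.le h1
  · have := inj hs.le ht h1
    have := inj hs ht.le h2
    omega

lemma infix_idx {u v a b : U} {P : G.Walk u v} (hP : P.IsPath) {S : G.Walk a b}
    (hS : S.darts <:+: P.darts) (hne : S.edges ≠ []) :
    ∃ i j, i < j ∧ j ≤ P.length ∧ P.getVert i = a ∧ P.getVert j = b ∧
      ∀ t < P.length, (s(P.getVert t, P.getVert (t + 1)) ∈ S.edges ↔ i ≤ t ∧ t < j) := by
  have hnil : ¬ S.Nil := by
    intro h
    apply hne
    cases S with
    | nil => rfl
    | cons h' p => simp at h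
  have hsub := (SimpleGraph.Walk.isSubwalk_iff_darts_isInfix hnil).2 hS
  obtain ⟨X, Y, rfl⟩ := hsub
  have hpos : 0 < S.length := by
    rw [← SimpleGraph.Walk.length_edges]; exact List.length_pos_iff.2 hne
  have hg : ∀ t, t ≤ S.length → ((X.append S).append Y).getVert (X.length + t) = S.getVert t := by
    intro t ht
    rw [SimpleGraph.Walk.getVert_append, SimpleGraph.Walk.length_append]
    split_ifs with h
    · rw [SimpleGraph.Walk.getVert_append, if_neg (by omega)]
      congr 1; omega
    · have : t = S.length := by omega
      subst this
      simp
  refine ⟨X.length, X.length + S.length, by omega, ?_, ?_, ?_, ?_⟩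
  · simp only [SimpleGraph.Walk.length_append]; omega
  · have := hg 0 (by omega); simpa using this
  · have := hg S.length le_rfl; simpa using this
  · intro t ht
    rw [mem_edges_iff]
    constructor
    · rintro ⟨r, hr, he⟩
      rw [← hg r hr.le, ← hg (r + 1) hr, ← Nat.add_assoc] at he
      have := edge_inj hP ht (by simp only [SimpleGraph.Walk.length_append] at ht ⊢; omega) he
      omega
    · rintro ⟨h1, h2⟩
      refine ⟨t - X.length, by omega, ?_⟩
      rw [← hg (t - X.length) (by omega), ← hg (t - X.length + 1) (by omega)]
      have e1 : X.length + (t - X.length) = t := by omega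
      have e2 : X.length + (t - X.length + 1) = t + 1 := by omega
      rw [e1, e2]

lemma infix_idx3 {u v a b a' b' : U} {L : G.Walk u a} {M : G.Walk a b} {R : G.Walk b v}
    (hP : ((L.append M).append R).IsPath) {S : G.Walk a' b'}
    (hS : S.darts <:+: ((L.append M).append R).darts) (hne : S.edges ≠ []) :
    ∃ i j, i < j ∧ j ≤ L.length + M.length + R.length ∧
      (i ≤ L.length → L.getVert i = a') ∧
      (L.length ≤ i → i ≤ L.length + M.length → M.getVert (i - L.length) = a') ∧
      (L.length ≤ j → j ≤ L.length + M.length → M.getVert (j - L.length) = b') ∧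
      (L.length + M.length ≤ j → R.getVert (j - (L.length + M.length)) = b') ∧
      (∀ t < L.length, (s(L.getVert t, L.getVert (t + 1)) ∈ S.edges ↔ i ≤ t ∧ t < j)) ∧
      (∀ t < M.length, (s(M.getVert t, M.getVert (t + 1)) ∈ S.edges ↔
        i ≤ L.length + t ∧ L.length + t < j)) ∧
      (∀ t < R.length, (s(R.getVert t, R.getVert (t + 1)) ∈ S.edges ↔
        i ≤ L.length + M.length + t ∧ L.length + M.length + t < j)) := by
  obtain ⟨i, j, hij, hj, ha, hb, hE⟩ := infix_idx hP hS hne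
  simp only [SimpleGraph.Walk.length_append] at hj hE
  have gM : ∀ t, t ≤ M.length →
      ((L.append M).append R).getVert (L.length + t) = M.getVert t := by
    intro t ht
    rw [SimpleGraph.Walk.getVert_append, SimpleGraph.Walk.length_append]
    split_ifs with h
    · rw [SimpleGraph.Walk.getVert_append, if_neg (by omega)]
      congr 1; omega
    · have : t = M.length := by omega
      subst this
      simp
  have gL : ∀ t, t ≤ L.length → ((L.append M).append R).getVert t = L.getVert t := by
    intro t ht
    rw [← SimpleGraph.Walk.append_assoc, SimpleGraph.Walk.getVert_append]
    split_ifs with h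
    · rfl
    · have : t = L.length := by omega
      subst this
      simp
  have gR : ∀ t, ((L.append M).append R).getVert (L.length + M.length + t) = R.getVert t := by
    intro t
    rw [SimpleGraph.Walk.getVert_append, SimpleGraph.Walk.length_append, if_neg (by omega)]
    congr 1; omega
  refine ⟨i, j, hij, hj, ?_, ?_, ?_, ?_, ?_, ?_, ?_⟩
  · intro h; rw [← gL i h, ha]
  · intro h h'; rw [← gM _ (by omega), Nat.add_sub_cancel' h, ha]
  · intro h h'; rw [← gM _ (by omega), Nat.add_sub_cancel' h, hb]
  · intro h; rw [← gR, Nat.add_sub_cancel' h, hb]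
  · intro t ht
    rw [← gL t ht.le, ← gL (t + 1) ht]; exact hE t (by omega)
  · intro t ht
    rw [← gM t ht.le, ← gM (t + 1) ht]; exact hE _ (by omega)
  · intro t ht
    rw [← gR t, ← gR (t + 1)]; exact hE _ (by omega)

/-- A segment of a path. -/
lemma seg_path {u v : U} (p : G.Walk u v) (hp : p.IsPath) {i j : ℕ} (hij : i ≤ j)
    (hj : j ≤ p.length) {x y : U} (hx : p.getVert i = x) (hy : p.getVert j = y) :
    ∃ q : G.Walk x y, q.IsPath ∧ q.length = j - i ∧
      (∀ z ∈ q.support, ∃ t, i ≤ t ∧ t ≤ j ∧ z = p.getVert t) ∧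
      (∀ z ∈ q.support, z ∈ p.support) ∧ (∀ e ∈ q.edges, e ∈ p.edges) := by
  obtain ⟨q, h1, h2, -, h4, h5⟩ := seg_full (fun _ => 0) p hp hij hj hx hy
  refine ⟨q, h1, h2, fun z hz => (h4 z).1 hz, ?_, ?_⟩
  · intro z hz
    obtain ⟨t, -, -, rfl⟩ := (h4 z).1 hz
    exact p.getVert_mem_support t
  · intro e he
    obtain ⟨t, h, h', rfl⟩ := (h5 e).1 he
    exact (mem_edges_iff p _).2 ⟨t, by omega, rfl⟩

/-- Connecting two vertices of a path. -/
lemma conn_path {u v : U} (p : G.Walk u v) (hp : p.IsPath) {x y : U} (hx : x ∈ p.support)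
    (hy : y ∈ p.support) : ∃ q : G.Walk x y, q.IsPath ∧ (∀ z ∈ q.support, z ∈ p.support) ∧
      (∀ e ∈ q.edges, e ∈ p.edges) := by
  obtain ⟨i, hi, hi'⟩ := SimpleGraph.Walk.mem_support_iff_exists_getVert.1 hx
  obtain ⟨j, hj, hj'⟩ := SimpleGraph.Walk.mem_support_iff_exists_getVert.1 hy
  rcases le_total i j with h | h
  · obtain ⟨q, h1, -, -, h4, h5⟩ := seg_path p hp h hj' hi hj
    exact ⟨q, h1, h4, h5⟩
  · obtain ⟨q, h1, -, -, h4, h5⟩ := seg_path p hp h hi' hj hi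
    exact ⟨q.reverse, h1.reverse, by simpa using h4, by simpa using h5⟩

end bcidx

section skel
variable {U : Type*} {G : SimpleGraph U} {u v w x : U}

lemma path_ne {y z : U} {p : G.Walk y z} (hp : p.IsPath) (hl : 1 ≤ p.length) : y ≠ z := by
  rintro rfl
  have := hp.getVert_injOn (x₁ := 0) (x₂ := p.length) (by simp) (by simp) (by simp)
  omega

lemma edges_of_len {y z : U} {p : G.Walk y z} (hl : 1 ≤ p.length) :
    ∃ e, e ∈ p.edges := by
  apply List.exists_mem_of_ne_nil
  rw [← List.length_pos_iff, SimpleGraph.Walk.length_edges]; exact hl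

lemma len_of_edges {y z : U} {p : G.Walk y z} (hl : p.edges ≠ []) : 1 ≤ p.length := by
  rw [← SimpleGraph.Walk.length_edges]; exact List.length_pos_iff.2 hl

lemma len_of_ne {y z : U} (p : G.Walk y z) (h : y ≠ z) : 1 ≤ p.length := by
  by_contra hc
  exact h (SimpleGraph.Walk.eq_of_length_eq_zero (p := p) (by omega))

lemma forest_meet {S : Set (Sym2 U)} (hS : (SimpleGraph.fromEdgeSet S).IsAcyclic)
    {z a y y' : U} {L : G.Walk z a} {P : G.Walk y y'} (hL : L.IsPath) (hP : P.IsPath)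
    (hLS : ∀ e ∈ L.edges, e ∈ S) (hPS : ∀ e ∈ P.edges, e ∈ S)
    (hno : ∀ e ∈ L.edges, e ∉ P.edges) (hz : z ∈ P.support) (ha : a ∈ P.support) : z = a := by
  by_contra hne
  obtain ⟨q, hq, -, hqe⟩ := conn_path P hP hz ha
  have := forest_unique hS hL hq hLS (fun e he => hPS e (hqe e he))
  obtain ⟨e, he⟩ := edges_of_len (len_of_ne L hne)
  exact hno e he (hqe e (this ▸ he))

/-- The relevant parts of the skeleton of a bad configuration. -/
structure Skel (B : PBC G u v w x) where
  A : G.Walk B.a2 B.a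
  M1 : G.Walk B.a B.a3
  D : G.Walk B.a3 B.b2
  E : G.Walk B.b B.b3
  R : G.Walk B.b B.b1
  T0 : G.Walk B.a1 B.a
  pA : A.IsPath
  pM1 : M1.IsPath
  pD : D.IsPath
  pE : E.IsPath
  pR : R.IsPath
  pT0 : T0.IsPath
  lA : 1 ≤ A.length
  lM1 : 1 ≤ M1.length
  lD : 1 ≤ D.length
  lE : 1 ≤ E.length
  lR : 1 ≤ R.length
  sA : ∀ z ∈ A.support, z ∈ B.Ll.support
  sM1 : ∀ z ∈ M1.support, z ∈ B.M.support
  sD : ∀ z ∈ D.support, z ∈ B.M.support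
  sE : ∀ z ∈ E.support, z ∈ B.Rl.support
  sR : ∀ z ∈ R.support, z ∈ B.Ru.support
  sT0 : (∀ z ∈ T0.support, z ∈ B.Lu.support) ∨ (∀ z ∈ T0.support, z ∈ M1.support ∧ z ≠ B.a3)
  eA : ∀ e ∈ A.edges, e ∈ B.Pl.edges
  eM1 : ∀ e ∈ M1.edges, e ∈ B.Pl.edges
  eD : ∀ e ∈ D.edges, e ∈ B.Pl.edges
  eE : ∀ e ∈ E.edges, e ∈ B.Pl.edges
  eR : ∀ e ∈ R.edges, e ∈ B.Pu.edges
  eT0 : ∀ e ∈ T0.edges, e ∈ B.Pu.edges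
  mD : ∀ z ∈ M1.support, z ∈ D.support → z = B.a3
  bM1 : B.b ∉ M1.support
  bD : B.b ∉ D.support
  aD : B.a ∉ D.support
  small : B.Small → (∀ e ∈ B.M.edges, e ∈ B.S1.edges) → B.a1 = B.a
  LlM : ∀ z ∈ B.Ll.support, z ∈ B.M.support → z = B.a
  LlRl : ∀ z ∈ B.Ll.support, z ∉ B.Rl.support
  MRl : ∀ z ∈ B.M.support, z ∈ B.Rl.support → z = B.b
  LuM : ∀ z ∈ B.Lu.support, z ∈ B.M.support → z = B.a
  LuRu : ∀ z ∈ B.Lu.support, z ∉ B.Ru.support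
  MRu : ∀ z ∈ B.M.support, z ∈ B.Ru.support → z = B.b
  LuLl : ∀ z ∈ B.Lu.support, z ∈ B.Ll.support → z = B.a
  LuRl : ∀ z ∈ B.Lu.support, z ∉ B.Rl.support
  RuLl : ∀ z ∈ B.Ru.support, z ∉ B.Ll.support
  RuRl : ∀ z ∈ B.Ru.support, z ∈ B.Rl.support → z = B.b

lemma exists_skel (B : PBC G u v w x) : Nonempty (Skel B) := by
  have pLu : B.Lu.IsPath := B.hPu.of_append_left.of_append_left
  have pM : B.M.IsPath := B.hPu.of_append_left.of_append_right
  have pRu : B.Ru.IsPath := B.hPu.of_append_right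
  have pLl : B.Ll.IsPath := B.hPl.of_append_left.of_append_left
  have pRl : B.Rl.IsPath := B.hPl.of_append_right
  have lM := len_of_edges B.hM_ne
  have hab : B.a ≠ B.b := path_ne pM lM
  have Minj : ∀ {i j : ℕ}, i ≤ B.M.length → j ≤ B.M.length → B.M.getVert i = B.M.getVert j → i = j :=
    fun hi hj h => pM.getVert_injOn hi hj h
  have LlM : ∀ z ∈ B.Ll.support, z ∈ B.M.support → z = B.a :=
    fun z h1 h2 => append_disj B.hPl.of_append_left h1 h2
  have LuM : ∀ z ∈ B.Lu.support, z ∈ B.M.support → z = B.a :=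
    fun z h1 h2 => append_disj B.hPu.of_append_left h1 h2
  have MRl : ∀ z ∈ B.M.support, z ∈ B.Rl.support → z = B.b :=
    fun z h1 h2 => append_disj B.hPl
      (by simp [SimpleGraph.Walk.mem_support_append_iff, h1]) h2
  have MRu : ∀ z ∈ B.M.support, z ∈ B.Ru.support → z = B.b :=
    fun z h1 h2 => append_disj B.hPu
      (by simp [SimpleGraph.Walk.mem_support_append_iff, h1]) h2
  have LlRl : ∀ z ∈ B.Ll.support, z ∉ B.Rl.support := by
    intro z h1 h2
    have hz := append_disj B.hPl
      (by simp [SimpleGraph.Walk.mem_support_append_iff, h1]) h2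
    subst hz
    exact hab (LlM _ h1 B.M.end_mem_support).symm
  have LuRu : ∀ z ∈ B.Lu.support, z ∉ B.Ru.support := by
    intro z h1 h2
    have hz := append_disj B.hPu
      (by simp [SimpleGraph.Walk.mem_support_append_iff, h1]) h2
    subst hz
    exact hab (LuM _ h1 B.M.end_mem_support).symm
  have hLuPl : ∀ z ∈ B.Lu.support, z ∈ ((B.Ll.append B.M).append B.Rl).support → z = B.a := by
    intro z h1 h2
    obtain ⟨X, Y, hXY⟩ := split_at B.Lu h1
    have hYe : ∀ e ∈ Y.edges, e ∈ B.Lu.edges := by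
      intro e he; rw [hXY]; simp [he]
    refine forest_meet B.hforest (L := Y) (P := (B.Ll.append B.M).append B.Rl)
      (by rw [hXY] at pLu; exact pLu.of_append_right) B.hPl ?_ (fun e he => Or.inr he) ?_ h2
      (by simp [SimpleGraph.Walk.mem_support_append_iff])
    · intro e he; exact Or.inl (by simp [hYe e he])
    · intro e he he'
      have := B.hmeet e (by simp [hYe e he]) he'
      exact edges_disj LuM (hYe e he) this
  have hRuPl : ∀ z ∈ B.Ru.support, z ∈ ((B.Ll.append B.M).append B.Rl).support → z = B.b := by
    intro z h1 h2
    obtain ⟨X, Y, hXY⟩ := split_at B.Ru h1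
    have hXe : ∀ e ∈ X.edges, e ∈ B.Ru.edges := by
      intro e he; rw [hXY]; simp [he]
    refine forest_meet B.hforest (L := X.reverse) (P := (B.Ll.append B.M).append B.Rl)
      (by rw [hXY] at pRu; exact pRu.of_append_left.reverse) B.hPl ?_ (fun e he => Or.inr he) ?_ h2
      (by simp [SimpleGraph.Walk.mem_support_append_iff])
    · intro e he
      rw [SimpleGraph.Walk.edges_reverse, List.mem_reverse] at he
      exact Or.inl (by simp [hXe e he])
    · intro e he he'
      rw [SimpleGraph.Walk.edges_reverse, List.mem_reverse] at he
      have := B.hmeet e (by simp [hXe e he]) he'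
      exact edges_disj MRu this (hXe e he)
  have inLl : ∀ z ∈ B.Ll.support, z ∈ ((B.Ll.append B.M).append B.Rl).support := by
    intro z hz; simp [SimpleGraph.Walk.mem_support_append_iff, hz]
  have inRl : ∀ z ∈ B.Rl.support, z ∈ ((B.Ll.append B.M).append B.Rl).support := by
    intro z hz; simp [SimpleGraph.Walk.mem_support_append_iff, hz]
  have LuRl : ∀ z ∈ B.Lu.support, z ∉ B.Rl.support := by
    intro z h1 h2
    have := hLuPl z h1 (inRl z h2)
    subst this
    exact LlRl _ B.Ll.end_mem_support h2
  have RuLl : ∀ z ∈ B.Ru.support, z ∉ B.Ll.support := by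
    intro z h1 h2
    have := hRuPl z h1 (inLl z h2)
    subst this
    exact LlRl _ h2 B.Rl.start_mem_support
  -- indices
  have ne1 : B.S1.edges ≠ [] := by
    obtain ⟨e, he, -⟩ := B.hC1Ru; exact List.ne_nil_of_mem he
  have ne2 : B.S2.edges ≠ [] := by
    obtain ⟨e, he, -⟩ := B.hC2Ll; exact List.ne_nil_of_mem he
  have ne3 : B.S3.edges ≠ [] := by
    obtain ⟨e, he, -⟩ := B.hC3Rl; exact List.ne_nil_of_mem he
  obtain ⟨i1, j1, ij1, jl1, aL1, aM1, bM1, bR1, eL1, eM1, eR1⟩ := infix_idx3 B.hPu B.hS1 ne1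
  obtain ⟨i2, j2, ij2, jl2, aL2, aM2, bM2, bR2, eL2, eM2, eR2⟩ := infix_idx3 B.hPl B.hS2 ne2
  obtain ⟨i3, j3, ij3, jl3, aL3, aM3, bM3, bR3, eL3, eM3, eR3⟩ := infix_idx3 B.hPl B.hS3 ne3
  have f1 : B.Lu.length + B.M.length < j1 := by
    obtain ⟨e, he, he'⟩ := B.hC1Ru
    obtain ⟨t, ht, rfl⟩ := (mem_edges_iff _ _).1 he'
    have := (eR1 t ht).1 he
    omega
  have f2 : i2 < B.Ll.length := by
    obtain ⟨e, he, he'⟩ := B.hC2Ll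
    obtain ⟨t, ht, rfl⟩ := (mem_edges_iff _ _).1 he'
    have := (eL2 t ht).1 he
    omega
  have f2a : B.Ll.length < j2 := by
    obtain ⟨e, he, he'⟩ := B.hC2M
    obtain ⟨t, ht, rfl⟩ := (mem_edges_iff _ _).1 he'
    have := (eM2 t ht).1 he
    omega
  have f2b : j2 < B.Ll.length + B.M.length := by
    obtain ⟨e, he', he⟩ := B.hMC2
    obtain ⟨t, ht, rfl⟩ := (mem_edges_iff _ _).1 he'
    by_contra hc
    exact he ((eM2 t ht).2 (by omega))
  have f3 : B.Ll.length + B.M.length < j3 := by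
    obtain ⟨e, he, he'⟩ := B.hC3Rl
    obtain ⟨t, ht, rfl⟩ := (mem_edges_iff _ _).1 he'
    have := (eR3 t ht).1 he
    omega
  have f3a : B.Ll.length < i3 := by
    obtain ⟨e, he', he⟩ := B.hMC3
    obtain ⟨t, ht, rfl⟩ := (mem_edges_iff _ _).1 he'
    by_contra hc
    exact he ((eM3 t ht).2 (by omega))
  have f23 : i3 < j2 := by
    obtain ⟨e, he', he, he''⟩ := B.hC_ne
    obtain ⟨t, ht, rfl⟩ := (mem_edges_iff _ _).1 he'
    have := (eM2 t ht).1 he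
    have := (eM3 t ht).1 he''
    omega
  have f13 : i1 + B.Ll.length < i3 + B.Lu.length := by
    obtain ⟨e, he', h1, h2, h3⟩ := B.hC1C2
    obtain ⟨t, ht, rfl⟩ := (mem_edges_iff _ _).1 he'
    have h1 := (eM1 t ht).1 h1
    have h2 := (eM2 t ht).1 h2
    have h3 : ¬ _ := fun h => h3 ((eM3 t ht).2 h)
    omega
  obtain ⟨A, pA, lA, -, sA, eA⟩ := seg_path B.Ll pLl f2.le le_rfl (aL2 f2.le) B.Ll.getVert_length
  obtain ⟨M1, pM1, lM1, gM1, sM1, eM1'⟩ := seg_path B.M pM (Nat.zero_le (i3 - B.Ll.length))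
    (by omega) B.M.getVert_zero (aM3 f3a.le (by omega))
  obtain ⟨D, pD, lD, gD, sD, eD⟩ := seg_path B.M pM
    (show i3 - B.Ll.length ≤ j2 - B.Ll.length by omega)
    (by omega) (aM3 f3a.le (by omega)) (bM2 f2a.le f2b.le)
  obtain ⟨E, pE, lE, -, sE, eE⟩ := seg_path B.Rl pRl
    (Nat.zero_le (j3 - (B.Ll.length + B.M.length))) (by omega) B.Rl.getVert_zero (bR3 f3.le)
  obtain ⟨R, pR, lR, -, sR, eR⟩ := seg_path B.Ru pRu
    (Nat.zero_le (j1 - (B.Lu.length + B.M.length))) (by omega) B.Ru.getVert_zero (bR1 f1.le)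
  have hT : ∃ T0 : G.Walk B.a1 B.a, T0.IsPath ∧ (∀ e ∈ T0.edges, e ∈ B.Pu.edges) ∧
      ((∀ z ∈ T0.support, z ∈ B.Lu.support) ∨ (∀ z ∈ T0.support, z ∈ M1.support ∧ z ≠ B.a3)) := by
    by_cases hi : i1 ≤ B.Lu.length
    · obtain ⟨T, pT, -, -, sT, eT⟩ := seg_path B.Lu pLu hi le_rfl (aL1 hi) B.Lu.getVert_length
      exact ⟨T, pT, fun e he => by simp [PBC.Pu, eT e he], Or.inl sT⟩
    · have hv := aM1 (by omega) (by omega)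
      have hlt : i1 - B.Lu.length < i3 - B.Ll.length := by omega
      have hcon : ∀ s, s ≤ i3 - B.Ll.length → B.M.getVert s ∈ M1.support := by
        intro s hs
        obtain ⟨q, hq, -, -, hq', hqe⟩ := seg_full (fun _ => 0) B.M pM
          (Nat.zero_le (i3 - B.Ll.length)) (by omega) B.M.getVert_zero (aM3 f3a.le (by omega))
        have : M1 = q := by
          apply forest_unique B.hforest pM1 hq
          · intro e he
            exact Or.inl (by simp [eM1' e he])
          · intro e he
            obtain ⟨t, h, h', rfl⟩ := (hqe e).1 he
            have := (mem_edges_iff B.M _).2 ⟨t, by omega, rfl⟩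
            exact Or.inl (by simp [this])
        rw [this]
        exact (hq' _).2 ⟨s, by omega, hs, rfl⟩
      obtain ⟨T, pT, -, gT, sT, eT⟩ := seg_path B.M pM (Nat.zero_le (i1 - B.Lu.length))
        (by omega) B.M.getVert_zero hv
      refine ⟨T.reverse, pT.reverse, fun e he => ?_, Or.inr ?_⟩
      · rw [SimpleGraph.Walk.edges_reverse, List.mem_reverse] at he
        simp [PBC.Pu, eT e he]
      · intro z hz
        rw [SimpleGraph.Walk.support_reverse, List.mem_reverse] at hz
        obtain ⟨t, -, ht, rfl⟩ := gT z hz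
        refine ⟨hcon t (by omega), fun h => ?_⟩
        rw [← aM3 f3a.le (by omega)] at h
        have := Minj (by omega) (by omega) h
        omega
  obtain ⟨T0, pT0, eT0, sT0⟩ := hT
  refine ⟨⟨A, M1, D, E, R, T0, pA, pM1, pD, pE, pR, pT0, by omega, by omega, by omega, by omega,
    by omega, sA, sM1, sD, sE, sR, sT0, ?_, ?_, ?_, ?_, ?_, eT0, ?_, ?_, ?_, ?_, ?_, LlM, LlRl, MRl,
    LuM, LuRu, MRu, fun z h1 h2 => hLuPl z h1 (inLl z h2), LuRl, RuLl,
    fun z h1 h2 => hRuPl z h1 (inRl z h2)⟩⟩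
  · intro e he; simp [PBC.Pl, eA e he]
  · intro e he; simp [PBC.Pl, eM1' e he]
  · intro e he; simp [PBC.Pl, eD e he]
  · intro e he; simp [PBC.Pl, eE e he]
  · intro e he; simp [PBC.Pu, eR e he]
  · intro z h1 h2
    obtain ⟨s, hs, hs', rfl⟩ := gM1 z h1
    obtain ⟨t, ht, ht', h⟩ := gD _ h2
    have := Minj (by omega) (by omega) h
    rw [← aM3 f3a.le (by omega)]; congr 1; omega
  · intro h
    obtain ⟨t, ht, ht', h⟩ := gM1 _ h
    have := Minj le_rfl (by omega) (B.M.getVert_length.trans h)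
    omega
  · intro h
    obtain ⟨t, ht, ht', h⟩ := gD _ h
    have := Minj le_rfl (by omega) (B.M.getVert_length.trans h)
    omega
  · intro h
    obtain ⟨t, ht, ht', h⟩ := gD _ h
    have := Minj (Nat.zero_le _) (by omega) (B.M.getVert_zero.trans h)
    omega
  · intro hs hM
    have h1 : i1 ≤ B.Lu.length := by
      have := (eM1 0 lM).1 (hM _ ((mem_edges_iff _ _).2 ⟨0, lM, rfl⟩))
      omega
    have h2 : ¬ i1 < B.Lu.length := by
      intro h
      exact hs _ ((eL1 i1 h).2 ⟨le_rfl, ij1⟩) ((mem_edges_iff _ _).2 ⟨i1, h, rfl⟩)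
    have h3 : i1 = B.Lu.length := by omega
    rw [← aL1 h1, h3]; simp

end skel

section bccycle
variable {U : Type*} {G : SimpleGraph U} {u v w x : U}

lemma mem_Pu (B : PBC G u v w x) (z : U) :
    z ∈ B.Pu.support ↔ (z ∈ B.Lu.support ∨ z ∈ B.M.support) ∨ z ∈ B.Ru.support := by
  simp only [PBC.Pu, SimpleGraph.Walk.mem_support_append_iff]

lemma mem_Pl (B : PBC G u v w x) (z : U) :
    z ∈ B.Pl.support ↔ (z ∈ B.Ll.support ∨ z ∈ B.M.support) ∨ z ∈ B.Rl.support := by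
  simp only [PBC.Pl, SimpleGraph.Walk.mem_support_append_iff]

/-- The conclusion of the first part. -/
def LongCycle (B : PBC G u v w x) : Prop :=
  ∃ (y : U) (p : G.Walk y y), p.IsCycle ∧ 7 ≤ p.length ∧
    ∀ e ∈ p.edges, e ∈ B.Pu.edges ∨ e ∈ B.Pl.edges ∨
      e ∈ B.q1.edges ∨ e ∈ B.q2.edges ∨ e ∈ B.q3.edges

lemma Skel.a2_ne {B : PBC G u v w x} (K : Skel B) : B.a2 ≠ B.a := path_ne K.pA K.lA
lemma Skel.b3_ne {B : PBC G u v w x} (K : Skel B) : B.b ≠ B.b3 := path_ne K.pE K.lE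
lemma Skel.b1_ne {B : PBC G u v w x} (K : Skel B) : B.b ≠ B.b1 := path_ne K.pR K.lR
lemma Skel.a3_ne {B : PBC G u v w x} (K : Skel B) : B.a ≠ B.a3 := path_ne K.pM1 K.lM1
lemma Skel.b1_Ru {B : PBC G u v w x} (K : Skel B) : B.b1 ∈ B.Ru.support :=
  K.sR _ K.R.end_mem_support
lemma Skel.a2_Ll {B : PBC G u v w x} (K : Skel B) : B.a2 ∈ B.Ll.support :=
  K.sA _ K.A.start_mem_support
lemma Skel.b2_M {B : PBC G u v w x} (K : Skel B) : B.b2 ∈ B.M.support :=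
  K.sD _ K.D.end_mem_support
lemma Skel.b3_Rl {B : PBC G u v w x} (K : Skel B) : B.b3 ∈ B.Rl.support :=
  K.sE _ K.E.end_mem_support
lemma Skel.b1_Pl {B : PBC G u v w x} (K : Skel B) : B.b1 ∉ B.Pl.support := by
  intro h
  have h1 := K.b1_Ru
  have h2 := K.b1_ne
  rcases (mem_Pl B _).1 h with (h | h) | h
  · exact K.RuLl _ h1 h
  · exact h2 (K.MRu _ h h1).symm
  · exact h2 (K.RuRl _ h1 h).symm
lemma Skel.b1_b2 {B : PBC G u v w x} (K : Skel B) : B.b2 ≠ B.b1 := by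
  intro h
  exact K.b1_Pl ((mem_Pl B _).2 (Or.inl (Or.inr (h ▸ K.b2_M))))
lemma Skel.b1_a2 {B : PBC G u v w x} (K : Skel B) : B.a2 ≠ B.b1 := by
  intro h
  exact K.b1_Pl ((mem_Pl B _).2 (Or.inl (Or.inl (h ▸ K.a2_Ll))))
lemma Skel.a1_cases {B : PBC G u v w x} (K : Skel B) :
    B.a1 ∈ B.Lu.support ∨ (B.a1 ∈ K.M1.support ∧ B.a1 ≠ B.a3) := by
  rcases K.sT0 with h | h
  · exact Or.inl (h _ K.T0.start_mem_support)
  · exact Or.inr (h _ K.T0.start_mem_support)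
lemma Skel.a1_Pu {B : PBC G u v w x} (K : Skel B) : B.a1 ∈ B.Pu.support := by
  rw [mem_Pu]
  rcases K.a1_cases with h | h
  · exact Or.inl (Or.inl h)
  · exact Or.inl (Or.inr (K.sM1 _ h.1))
lemma Skel.a1_a2 {B : PBC G u v w x} (K : Skel B) : B.a2 ≠ B.a1 := by
  intro h
  have h2 := K.a2_Ll
  have h3 := K.a2_ne
  rw [h] at h2 h3
  rcases K.a1_cases with h | h
  · exact h3 (K.LuLl _ h h2)
  · exact h3 (K.LlM _ h2 (K.sM1 _ h.1))
lemma Skel.a1_b2 {B : PBC G u v w x} (K : Skel B) : B.b2 ≠ B.a1 := by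
  intro h
  have h2 := K.D.end_mem_support
  have h3 := K.b2_M
  rw [h] at h3
  rcases K.a1_cases with h' | h'
  · have := K.LuM _ h' h3
    have e : B.b2 = B.a := h.trans this
    have e2 : ∀ t, t = B.b2 → t ∈ K.D.support := by
      rintro t rfl
      exact h2
    exact K.aD (e2 _ e.symm)
  · rw [← h] at h'
    exact h'.2 (K.mD _ h'.1 h2)

lemma cycle_one {B : PBC G u v w x} (K : Skel B) {y : U} (r : G.Walk B.b1 y) (T : G.Walk y B.a2)
    (pr : r.IsPath) (pT : T.IsPath) (lr : 1 ≤ r.length) (lT : 1 ≤ T.length)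
    (hq2 : ∀ z ∈ B.q2.support, z ∈ B.Pu.support ∨ z ∈ B.Pl.support → z = B.a2 ∨ z = B.b2)
    (hq3 : ∀ z ∈ B.q3.support, z ∈ B.Pu.support ∨ z ∈ B.Pl.support → z = B.a3 ∨ z = B.b3)
    (hr : ∀ z ∈ r.support, z ∈ B.Pu.support ∨ z ∈ B.Pl.support → z = y ∨ z = B.b1)
    (sT : ∀ z ∈ T.support, z ∈ B.Lu.support ∨ z ∈ B.Ll.support ∨
      (z ∈ K.M1.support ∧ z ≠ B.a3))
    (r2 : ∀ z ∈ r.support, z ∉ B.q2.support) (r3 : ∀ z ∈ r.support, z ∉ B.q3.support)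
    (q23 : ∀ z ∈ B.q2.support, z ∉ B.q3.support)
    (er : ∀ e ∈ r.edges, e ∈ B.q1.edges)
    (eT : ∀ e ∈ T.edges, e ∈ B.Pu.edges ∨ e ∈ B.Pl.edges) : LongCycle B := by
  have lq2 := len_of_edges B.hq2_ne
  have lq3 := len_of_edges B.hq3_ne
  obtain ⟨Y, hY⟩ : ∃ Y : Set U, ∀ z, z ∈ Y ↔ z ∈ (K.E.reverse.append K.R).support :=
    ⟨{z | z ∈ (K.E.reverse.append K.R).support}, fun z => Iff.rfl⟩
  have hY' : ∀ z, z ∈ Y ↔ z ∈ K.E.support ∨ z ∈ K.R.support := by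
    intro z; rw [hY, SimpleGraph.Walk.mem_support_append_iff, SimpleGraph.Walk.support_reverse,
      List.mem_reverse]
  have XS : ∀ z ∈ K.D.support, z ∈ B.Pu.support ∨ z ∈ B.Pl.support := by
    intro z hz; left; rw [mem_Pu]; exact Or.inl (Or.inr (K.sD z hz))
  have YS : ∀ z ∈ Y, z ∈ B.Pu.support ∨ z ∈ B.Pl.support := by
    intro z hz
    rcases (hY' z).1 hz with h | h
    · right; rw [mem_Pl]; exact Or.inr (K.sE z h)
    · left; rw [mem_Pu]; exact Or.inr (K.sR z h)
  have ZS : ∀ z ∈ T.support, z ∈ B.Pu.support ∨ z ∈ B.Pl.support := by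
    intro z hz
    rw [mem_Pu, mem_Pl]
    rcases sT z hz with h | h | h
    · tauto
    · tauto
    · have := K.sM1 z h.1; tauto
  have XY : ∀ z ∈ K.D.support, z ∉ Y := by
    intro z hz hzY
    have hM := K.sD z hz
    have : z = B.b := by
      rcases (hY' z).1 hzY with h | h
      · exact K.MRl z hM (K.sE z h)
      · exact K.MRu z hM (K.sR z h)
    exact K.bD (this ▸ hz)
  have XZ : ∀ z ∈ K.D.support, z ∉ T.support := by
    intro z hz hzT
    have hM := K.sD z hz
    rcases sT z hzT with h | h | h
    · exact K.aD (K.LuM z h hM ▸ hz)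
    · exact K.aD (K.LlM z h hM ▸ hz)
    · exact h.2 (K.mD z h.1 hz)
  have YZ : ∀ z ∈ Y, z ∉ T.support := by
    intro z hz hzT
    rcases (hY' z).1 hz with h' | h' <;> rcases sT z hzT with h | h | h
    · exact K.LuRl z h (K.sE z h')
    · exact K.LlRl z h (K.sE z h')
    · exact K.bM1 (K.MRl z (K.sM1 z h.1) (K.sE z h') ▸ h.1)
    · exact K.LuRu z h (K.sR z h')
    · exact K.RuLl z (K.sR z h') h
    · exact K.bM1 (K.MRu z (K.sM1 z h.1) (K.sR z h') ▸ h.1)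
  have a3X := K.D.start_mem_support
  have b2X := K.D.end_mem_support
  have b3Y : B.b3 ∈ Y := (hY' _).2 (Or.inl K.E.end_mem_support)
  have b1Y : B.b1 ∈ Y := (hY' _).2 (Or.inr K.R.end_mem_support)
  have yZ := T.start_mem_support
  have a2Z := T.end_mem_support
  have pER : (K.E.reverse.append K.R).IsPath := by
    refine path_append K.pE.reverse K.pR ?_
    intro z h1 h2
    rw [SimpleGraph.Walk.support_reverse, List.mem_reverse] at h1
    exact K.RuRl z (K.sR z h2) (K.sE z h1)
  obtain ⟨C, hC, hl, he⟩ := hexagon (p1 := B.q2) (p2 := K.D.reverse) (p3 := B.q3)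
    (p4 := K.E.reverse.append K.R) (p5 := r) (p6 := T) B.hq2path K.pD.reverse B.hq3path pER pr pT
    lq2 (by simpa using K.lD)
    (by intro z; simp only [SimpleGraph.Walk.support_reverse, List.mem_reverse]; grind)
    (by intro z; simp only [SimpleGraph.Walk.support_reverse, List.mem_reverse]; grind)
    (by intro z; rw [← hY]; grind)
    (by intro z; rw [← hY]; grind)
    (by grind) (by grind) (by grind)
    (by intro z; rw [← hY]; grind)
    (by grind)
    (by intro z; rw [← hY]; simp only [SimpleGraph.Walk.support_reverse, List.mem_reverse]; grind)
    (by intro z; simp only [SimpleGraph.Walk.support_reverse, List.mem_reverse]; grind)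
    (by intro z; simp only [SimpleGraph.Walk.support_reverse, List.mem_reverse]; grind)
    (by grind) (by grind)
    (by intro z; rw [← hY]; grind)
  refine ⟨_, C, hC, ?_, ?_⟩
  · simp only [SimpleGraph.Walk.length_append, SimpleGraph.Walk.length_reverse] at hl
    have := K.lD
    have := K.lE
    have := K.lR
    omega
  · intro e h
    have h := he e h
    simp only [SimpleGraph.Walk.edges_append, SimpleGraph.Walk.edges_reverse, List.mem_append,
      List.mem_reverse] at h
    rcases h with h | h | h | (h | h) | h | h
    · tauto
    · have := K.eD e h; tauto
    · tauto
    · have := K.eE e h; tauto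
    · have := K.eR e h; tauto
    · have := er e h; tauto
    · have := eT e h; tauto

lemma cycle_two {B : PBC G u v w x} (K : Skel B) (r : G.Walk B.a2 B.b1)
    (pr : r.IsPath) (lr : 2 ≤ r.length)
    (hq3 : ∀ z ∈ B.q3.support, z ∈ B.Pu.support ∨ z ∈ B.Pl.support → z = B.a3 ∨ z = B.b3)
    (hr : ∀ z ∈ r.support, z ∈ B.Pu.support ∨ z ∈ B.Pl.support → z = B.a2 ∨ z = B.b1)
    (r3 : ∀ z ∈ r.support, z ∉ B.q3.support)
    (er : ∀ e ∈ r.edges, e ∈ B.q1.edges ∨ e ∈ B.q2.edges) : LongCycle B := by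
  have lq3 := len_of_edges B.hq3_ne
  have RS : ∀ z ∈ K.R.support, z ∈ B.Pu.support ∨ z ∈ B.Pl.support := by
    intro z hz; left; rw [mem_Pu]; exact Or.inr (K.sR z hz)
  have ES : ∀ z ∈ K.E.support, z ∈ B.Pu.support ∨ z ∈ B.Pl.support := by
    intro z hz; right; rw [mem_Pl]; exact Or.inr (K.sE z hz)
  have MS : ∀ z ∈ K.M1.support, z ∈ B.Pu.support ∨ z ∈ B.Pl.support := by
    intro z hz; right; rw [mem_Pl]; exact Or.inl (Or.inr (K.sM1 z hz))
  have AS : ∀ z ∈ K.A.support, z ∈ B.Pu.support ∨ z ∈ B.Pl.support := by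
    intro z hz; right; rw [mem_Pl]; exact Or.inl (Or.inl (K.sA z hz))
  have RE : ∀ z ∈ K.R.support, z ∈ K.E.support → z = B.b :=
    fun z h1 h2 => K.RuRl z (K.sR z h1) (K.sE z h2)
  have RM : ∀ z ∈ K.R.support, z ∉ K.M1.support :=
    fun z h1 h2 => K.bM1 (K.MRu z (K.sM1 z h2) (K.sR z h1) ▸ h2)
  have RA : ∀ z ∈ K.R.support, z ∉ K.A.support :=
    fun z h1 h2 => K.RuLl z (K.sR z h1) (K.sA z h2)
  have EM : ∀ z ∈ K.E.support, z ∉ K.M1.support :=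
    fun z h1 h2 => K.bM1 (K.MRl z (K.sM1 z h2) (K.sE z h1) ▸ h2)
  have EA : ∀ z ∈ K.E.support, z ∉ K.A.support :=
    fun z h1 h2 => K.LlRl z (K.sA z h2) (K.sE z h1)
  have MA : ∀ z ∈ K.M1.support, z ∈ K.A.support → z = B.a :=
    fun z h1 h2 => K.LlM z (K.sA z h2) (K.sM1 z h1)
  have a2A := K.A.start_mem_support
  have b1R := K.R.end_mem_support
  have b3E := K.E.end_mem_support
  have a3M := K.M1.end_mem_support
  have n1 := K.a2_ne
  have n2 := K.b3_ne
  have n3 := K.b1_ne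
  have n4 := K.a3_ne
  obtain ⟨C, hC, hl, he⟩ := hexagon (p1 := r) (p2 := K.R.reverse) (p3 := K.E)
    (p4 := B.q3.reverse) (p5 := K.M1.reverse) (p6 := K.A.reverse) pr K.pR.reverse K.pE
    B.hq3path.reverse K.pM1.reverse K.pA.reverse
    (by omega) (by simpa using K.lR)
    (by intro z; simp only [SimpleGraph.Walk.support_reverse, List.mem_reverse]; grind)
    (by intro z; simp only [SimpleGraph.Walk.support_reverse, List.mem_reverse]; grind)
    (by intro z; simp only [SimpleGraph.Walk.support_reverse, List.mem_reverse]; grind)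
    (by intro z; simp only [SimpleGraph.Walk.support_reverse, List.mem_reverse]; grind)
    (by intro z; simp only [SimpleGraph.Walk.support_reverse, List.mem_reverse]; grind)
    (by intro z; simp only [SimpleGraph.Walk.support_reverse, List.mem_reverse]; grind)
    (by grind)
    (by intro z; simp only [SimpleGraph.Walk.support_reverse, List.mem_reverse]; grind)
    (by intro z; simp only [SimpleGraph.Walk.support_reverse, List.mem_reverse]; grind)
    (by intro z; simp only [SimpleGraph.Walk.support_reverse, List.mem_reverse]; grind)
    (by intro z; simp only [SimpleGraph.Walk.support_reverse, List.mem_reverse]; grind)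
    (by intro z; simp only [SimpleGraph.Walk.support_reverse, List.mem_reverse]; grind)
    (by intro z; simp only [SimpleGraph.Walk.support_reverse, List.mem_reverse]; grind)
    (by intro z; simp only [SimpleGraph.Walk.support_reverse, List.mem_reverse]; grind)
    (by intro z; simp only [SimpleGraph.Walk.support_reverse, List.mem_reverse]; grind)
  refine ⟨_, C, hC, ?_, ?_⟩
  · simp only [SimpleGraph.Walk.length_reverse] at hl
    have := K.lA
    have := K.lM1
    have := K.lE
    have := K.lR
    omega
  · intro e h
    have h := he e h
    simp only [SimpleGraph.Walk.edges_reverse, List.mem_reverse] at h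
    rcases h with h | h | h | h | h | h
    · have := er e h; tauto
    · have := K.eR e h; tauto
    · have := K.eE e h; tauto
    · tauto
    · have := K.eM1 e h; tauto
    · have := K.eA e h; tauto

lemma meet_first {B : PBC G u v w x} (h : ¬ PBC.NodeDisj B.q1 B.q2) :
    ∃ (z : U) (X : G.Walk B.a2 z) (Y : G.Walk z B.b2), B.q2 = X.append Y ∧ z ∈ B.q1.support ∧
      ∀ s ∈ X.support, s ∈ B.q1.support → s = z := by
  simp only [PBC.NodeDisj, not_forall, not_not] at h
  obtain ⟨s, h1, h2⟩ := h
  obtain ⟨X, Y, hXY⟩ := split_at B.q2 h2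
  obtain ⟨z, X1, X2, rfl, hz, hX⟩ := split_first X {s | s ∈ B.q1.support} h1
  exact ⟨z, X1, X2.append Y, by rw [hXY, SimpleGraph.Walk.append_assoc], hz, hX⟩

lemma omega_cycle {B : PBC G u v w x} (K : Skel B) {z : U} {X : G.Walk B.a2 z}
    {Y : G.Walk z B.b2} {Z' : G.Walk B.a1 z} {Z : G.Walk z B.b1} (hX : B.q2 = X.append Y)
    (hZ : B.q1 = Z'.append Z) (hz : ∀ s ∈ X.support, s ∈ B.q1.support → s = z)
    (hq2 : ∀ z ∈ B.q2.support, z ∈ B.Pu.support ∨ z ∈ B.Pl.support → z = B.a2 ∨ z = B.b2)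
    (hq3 : ∀ z ∈ B.q3.support, z ∈ B.Pu.support ∨ z ∈ B.Pl.support → z = B.a3 ∨ z = B.b3)
    (h31 : PBC.NodeDisj B.q3 B.q1) (h32 : PBC.NodeDisj B.q3 B.q2)
    (ha2 : B.a2 ∉ B.q1.support) (hb2 : B.b2 ∉ B.q1.support)
    (hr : ∀ s ∈ Z.support, s ∈ B.Pu.support ∨ s ∈ B.Pl.support → s = z ∨ s = B.b1) :
    LongCycle B := by
  have X2 : ∀ s ∈ X.support, s ∈ B.q2.support := by
    intro s hs; rw [hX, SimpleGraph.Walk.mem_support_append_iff]; exact Or.inl hs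
  have Z1 : ∀ s ∈ Z.support, s ∈ B.q1.support := by
    intro s hs; rw [hZ, SimpleGraph.Walk.mem_support_append_iff]; exact Or.inr hs
  have pX : X.IsPath := by have := B.hq2path; rw [hX] at this; exact this.of_append_left
  have pZ : Z.IsPath := by have := B.hq1path; rw [hZ] at this; exact this.of_append_right
  have zq1 : z ∈ B.q1.support := Z1 z Z.start_mem_support
  have zq2 : z ∈ B.q2.support := X2 z X.end_mem_support
  have n1 : B.a2 ≠ z := fun h => ha2 (h ▸ zq1)
  have zS : ¬ (z ∈ B.Pu.support ∨ z ∈ B.Pl.support) := by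
    intro h
    rcases hq2 z zq2 h with h | h
    · exact n1 h.symm
    · exact hb2 (h ▸ zq1)
  have n2 : z ≠ B.b1 := by
    intro h
    apply zS
    left; rw [mem_Pu, h]; exact Or.inr K.b1_Ru
  refine cycle_two K (X.append Z) (path_append pX pZ fun s h1 h2 => hz s h1 (Z1 s h2)) ?_ hq3 ?_ ?_ ?_
  · have := len_of_ne X n1
    have := len_of_ne Z n2
    rw [SimpleGraph.Walk.length_append]; omega
  · intro s hs hS
    rcases (SimpleGraph.Walk.mem_support_append_iff _ _).1 hs with h | h
    · rcases hq2 s (X2 s h) hS with h' | h'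
      · exact Or.inl h'
      · exfalso
        have hp := B.hq2path
        rw [hX] at hp
        have : s = z := append_disj hp h (by rw [h']; exact Y.end_mem_support)
        exact zS (this ▸ hS)
    · rcases hr s h hS with h' | h'
      · exact (zS (h' ▸ hS)).elim
      · exact Or.inr h'
  · intro s hs h3
    rcases (SimpleGraph.Walk.mem_support_append_iff _ _).1 hs with h | h
    · exact h32 s h3 (X2 s h)
    · exact h31 s h3 (Z1 s h)
  · intro e he
    rw [hX, hZ]
    simp only [SimpleGraph.Walk.edges_append, List.mem_append] at he ⊢
    tauto

lemma intern_iff {B : PBC G u v w x} {y z : U} {q : G.Walk y z} (h : B.InternDisj q) :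
    ∀ s ∈ q.support, s ∈ B.Pu.support ∨ s ∈ B.Pl.support → s = y ∨ s = z := by
  intro s hs hS
  by_contra hc
  rw [not_or] at hc
  have := h s hs hc.1 hc.2
  tauto

lemma avoids_iff {B : PBC G u v w x} {y z : U} {q : G.Walk y z} (h : B.AvoidsUpperOuter q)
    (hcl : ∀ s ∈ q.support, s ∈ ((B.Ll.append B.M).append B.Rl).support → s = y ∨ s = z) :
    ∀ s ∈ q.support, s ∈ B.Pu.support ∨ s ∈ B.Pl.support → s = y ∨ s = z := by
  intro s hs hS
  apply hcl s hs
  change s ∈ B.Pl.support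
  rcases hS with hS | hS
  · rcases (mem_Pu B s).1 hS with (h' | h') | h'
    · exact ((h s hs).1 h').elim
    · exact (mem_Pl B s).2 (Or.inl (Or.inr h'))
    · exact ((h s hs).2 h').elim
  · exact hS

lemma bc_one {B : PBC G u v w x} (K : Skel B) (h : B.BC1) : LongCycle B := by
  obtain ⟨h12, h13, h23, i1, i2, i3⟩ := h
  have hTA : ∀ z ∈ K.T0.support, z ∈ K.A.reverse.support → z = B.a := by
    intro z h1 h2
    rw [SimpleGraph.Walk.support_reverse, List.mem_reverse] at h2
    have h2 := K.sA z h2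
    rcases K.sT0 with h | h
    · exact K.LuLl z (h z h1) h2
    · exact K.LlM z h2 (K.sM1 z (h z h1).1)
  refine cycle_one K B.q1.reverse (K.T0.append K.A.reverse) B.hq1path.reverse
    (path_append K.pT0 K.pA.reverse hTA) (by simpa using len_of_edges B.hq1_ne) ?_
    (intern_iff i2) (intern_iff i3) ?_ ?_ ?_ ?_ h23 ?_ ?_
  · have := K.lA
    rw [SimpleGraph.Walk.length_append, SimpleGraph.Walk.length_reverse]; omega
  · intro z hz hS
    rw [SimpleGraph.Walk.support_reverse, List.mem_reverse] at hz
    exact intern_iff i1 z hz hS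
  · intro z hz
    rw [SimpleGraph.Walk.mem_support_append_iff, SimpleGraph.Walk.support_reverse,
      List.mem_reverse] at hz
    rcases hz with hz | hz
    · rcases K.sT0 with h | h
      · exact Or.inl (h z hz)
      · exact Or.inr (Or.inr (h z hz))
    · exact Or.inr (Or.inl (K.sA z hz))
  · intro z hz
    rw [SimpleGraph.Walk.support_reverse, List.mem_reverse] at hz
    exact h12 z hz
  · intro z hz
    rw [SimpleGraph.Walk.support_reverse, List.mem_reverse] at hz
    exact h13 z hz
  · simp
  · intro e he
    rw [SimpleGraph.Walk.edges_append, SimpleGraph.Walk.edges_reverse, List.mem_append,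
      List.mem_reverse] at he
    rcases he with he | he
    · exact Or.inl (K.eT0 e he)
    · exact Or.inr (K.eA e he)

lemma bc_two {B : PBC G u v w x} (K : Skel B) (h : B.BC2) : LongCycle B := by
  obtain ⟨h31, h32, hn, -, i1, i2, i3⟩ := h
  obtain ⟨z, X, Y, hX, hz, hm⟩ := meet_first hn
  obtain ⟨Z', Z, hZ⟩ := split_at B.q1 hz
  refine omega_cycle K hX hZ hm (intern_iff i2) (intern_iff i3) h31 h32 ?_ ?_ ?_
  · intro h
    rcases intern_iff i1 _ h (Or.inr ((mem_Pl B _).2 (Or.inl (Or.inl K.a2_Ll)))) with h | h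
    · exact K.a1_a2 h
    · exact K.b1_a2 h
  · intro h
    rcases intern_iff i1 _ h (Or.inr ((mem_Pl B _).2 (Or.inl (Or.inr K.b2_M)))) with h | h
    · exact K.a1_b2 h
    · exact K.b1_b2 h
  · intro s hs hS
    have hs1 : s ∈ B.q1.support := by
      rw [hZ, SimpleGraph.Walk.mem_support_append_iff]; exact Or.inr hs
    rcases intern_iff i1 s hs1 hS with h | h
    · left
      have hp := B.hq1path
      rw [hZ] at hp
      exact append_disj hp (by rw [h]; exact Z'.start_mem_support) hs
    · exact Or.inr h

lemma bc_three {B : PBC G u v w x} (K : Skel B) (h : B.BC3) : LongCycle B := by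
  obtain ⟨hsm, hMS, h12, h13, h23, av2, av3, hRl, ha2, y, α, β, hq, hy, hα, hβ⟩ := h
  have ha : B.a1 = B.a := K.small hsm hMS
  have pLl : B.Ll.IsPath := B.hPl.of_append_left.of_append_left
  have bq : ∀ s ∈ β.support, s ∈ B.q1.support := by
    intro s hs; rw [hq, SimpleGraph.Walk.mem_support_append_iff]; exact Or.inr hs
  have yq := bq y β.start_mem_support
  have y2 : y ≠ B.a2 := fun h => ha2 (h ▸ yq)
  have y1 : y ≠ B.b1 := by
    intro h
    exact K.b1_Pl ((mem_Pl B _).2 (Or.inl (Or.inl (h ▸ hy))))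
  obtain ⟨T, pT, sT, eT⟩ := conn_path B.Ll pLl hy K.a2_Ll
  have pβ : β.IsPath := by
    have hp := B.hq1path
    rw [hq] at hp
    exact hp.of_append_right
  have hPu : ∀ s ∈ β.support, s ∈ B.Pu.support → s = y ∨ s = B.b1 := by
    intro s hs hS
    rcases B.hq1closes s (bq s hs) hS with h | h
    · left
      apply hβ s hs
      rw [h, ha]; exact B.Ll.end_mem_support
    · exact Or.inr h
  refine cycle_one K β.reverse T pβ.reverse pT (by simpa using len_of_ne β y1) (len_of_ne T y2)
    (avoids_iff av2 B.hq2closes) (avoids_iff av3 B.hq3closes) ?_ ?_ ?_ ?_ h23 ?_ ?_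
  · intro z hz hS
    rw [SimpleGraph.Walk.support_reverse, List.mem_reverse] at hz
    rcases hS with hS | hS
    · exact hPu z hz hS
    · rcases (mem_Pl B z).1 hS with (h | h) | h
      · exact Or.inl (hβ z hz h)
      · exact hPu z hz ((mem_Pu B z).2 (Or.inl (Or.inr h)))
      · exact (hRl z (bq z hz) h).elim
  · intro z hz; exact Or.inr (Or.inl (sT z hz))
  · intro z hz
    rw [SimpleGraph.Walk.support_reverse, List.mem_reverse] at hz
    exact h12 z (bq z hz)
  · intro z hz
    rw [SimpleGraph.Walk.support_reverse, List.mem_reverse] at hz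
    exact h13 z (bq z hz)
  · intro e he
    rw [SimpleGraph.Walk.edges_reverse, List.mem_reverse] at he
    rw [hq]; simp [he]
  · intro e he
    right; simp [PBC.Pl, eT e he]

lemma infix_edges {y z y' z' : U} {S : G.Walk y z} {P : G.Walk y' z'}
    (h : S.darts <:+: P.darts) : ∀ e ∈ S.edges, e ∈ P.edges := by
  intro e he
  obtain ⟨d, hd, rfl⟩ := List.mem_map.1 he
  exact List.mem_map.2 ⟨d, h.subset hd, rfl⟩

lemma bc_four {B : PBC G u v w x} (K : Skel B) (h : B.BC4) : LongCycle B := by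
  obtain ⟨hsm, hMS, h31, h32, hn, -, av2, av3, hRl, ha2, y, α, β, hq, hy, hα, hβ⟩ := h
  have ha : B.a1 = B.a := K.small hsm hMS
  have hq2 := avoids_iff av2 B.hq2closes
  have hq3 := avoids_iff av3 B.hq3closes
  obtain ⟨z, X, Y, hX, hz, hm⟩ := meet_first hn
  have zq2 : z ∈ B.q2.support := by
    rw [hX, SimpleGraph.Walk.mem_support_append_iff]; exact Or.inl X.end_mem_support
  have hb2 : B.b2 ∉ B.q1.support := by
    intro h
    rcases B.hq1closes _ h ((mem_Pu B _).2 (Or.inl (Or.inr K.b2_M))) with h | h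
    · exact K.a1_b2 h
    · exact K.b1_b2 h
  have zS : ¬ (z ∈ B.Pu.support ∨ z ∈ B.Pl.support) := by
    intro h
    rcases hq2 z zq2 h with h | h
    · exact ha2 (h ▸ hz)
    · exact hb2 (h ▸ hz)
  have zα : z ∉ α.support := by
    intro h
    rcases SimpleGraph.Walk.mem_support_iff_exists_mem_edges.1 h with h' | ⟨e, he, hze⟩
    · apply zS
      have hy' : z ∈ B.Ll.support := h' ▸ hy
      exact Or.inr ((mem_Pl B z).2 (Or.inl (Or.inl hy')))
    · apply zS
      right
      have he' := infix_edges B.hS2 e (hα e he)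
      exact SimpleGraph.Walk.mem_support_of_mem_edges he' hze
  have zβ : z ∈ β.support := by
    rw [hq, SimpleGraph.Walk.mem_support_append_iff] at hz
    exact hz.resolve_left zα
  obtain ⟨β1, Z, hβZ⟩ := split_at β zβ
  have hZ : B.q1 = (α.append β1).append Z := by
    rw [hq, hβZ, SimpleGraph.Walk.append_assoc]
  have hp := B.hq1path
  rw [hZ] at hp
  refine omega_cycle K hX hZ hm hq2 hq3 h31 h32 ha2 hb2 ?_
  have hPu : ∀ s ∈ Z.support, s ∈ B.Pu.support → s = z ∨ s = B.b1 := by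
    intro s hs hS
    have hs1 : s ∈ B.q1.support := by
      rw [hZ, SimpleGraph.Walk.mem_support_append_iff]; exact Or.inr hs
    rcases B.hq1closes s hs1 hS with h | h
    · left
      exact append_disj hp (by rw [h]; exact (α.append β1).start_mem_support) hs
    · exact Or.inr h
  intro s hs hS
  rcases hS with hS | hS
  · exact hPu s hs hS
  · rcases (mem_Pl B s).1 hS with (h | h) | h
    · left
      have hsβ : s ∈ β.support := by
        rw [hβZ, SimpleGraph.Walk.mem_support_append_iff]; exact Or.inr hs
      have := hβ s hsβ h
      refine append_disj hp ?_ hs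
      rw [SimpleGraph.Walk.mem_support_append_iff, this]
      exact Or.inr β1.start_mem_support
    · exact hPu s hs ((mem_Pu B s).2 (Or.inl (Or.inr h)))
    · refine (hRl s ?_ h).elim
      rw [hZ, SimpleGraph.Walk.mem_support_append_iff]; exact Or.inr hs

lemma part_one (B : PBC G u v w x) (h : B.IsBC) : LongCycle B := by
  obtain ⟨K⟩ := exists_skel B
  rcases h with h | h | h | h
  · exact bc_one K h
  · exact bc_two K h
  · exact bc_three K h
  · exact bc_four K h

end bccycle

/-- Every bad configuration contains a cycle of length at
least 7; consequently, every graph in which all cycles have length at most 6 is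
strongly efficient for every placement of the terminal pairs. -/
theorem bc_long_cycle_and_short_cycles_strongly_efficient :
    (∀ {W : Type*} (H : SimpleGraph W) (u v w x : W) (B : PBC H u v w x),
      B.IsBC → ∃ (y : W) (p : H.Walk y y), p.IsCycle ∧ 7 ≤ p.length ∧
        ∀ e ∈ p.edges, e ∈ B.Pu.edges ∨ e ∈ B.Pl.edges ∨
          e ∈ B.q1.edges ∨ e ∈ B.q2.edges ∨ e ∈ B.q3.edges) ∧
    (∀ (W : Type*) [DecidableEq W] [Fintype W] (H : SimpleGraph W),
      (∀ (y : W) (p : H.Walk y y), p.IsCycle → p.length ≤ 6) →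
      ∀ s₁ t₁ s₂ t₂ : W, StronglyEfficient H s₁ t₁ s₂ t₂) := by
  refine ⟨?_, ?_⟩
  · intro W H u v w x B hB
    exact part_one B hB
  · intro W _ _ H circ s₁ t₁ s₂ t₂
    exact part_two circ s₁ t₁ s₂ t₂

end NDG
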